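/- arXiv:1210.3644 — 7 statements merged into one kernel-verified Lean document; each statement's English description precedes it below -/
import Mathlib

section
/- For every prime number p and all nonzero elements a, b, c of the field ℚ_p of p-adic numbers, there exist x, y ∈ ℚ_p such that c = x² − a·y², or c = x² − b·y², or c = x² − (a·b)·y². (Equivalently: c is a norm from at least one of the three étale quadratic algebras ℚ_p(√a), ℚ_p(√b), ℚ_p(√(ab)).) -/
namespace PadicNormAux

/-- `a` is a value of the form `x² - c y²`. -/
def NR {K : Type*} [Field K] (c a : K) : Prop := ∃ x y : K, a = x ^ 2 - c * y ^ 2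

section field
variable {K : Type*} [Field K]

lemma NR.mul {c a b : K} (h : NR c a) (h' : NR c b) : NR c (a * b) := by
  obtain ⟨x, y, rfl⟩ := h
  obtain ⟨z, w, rfl⟩ := h'
  exact ⟨x * z + c * y * w, x * w + y * z, by ring⟩

lemma NR.sq (c t : K) : NR c (t ^ 2) := ⟨t, 0, by ring⟩

lemma NR.neg (c : K) : NR c (-c) := ⟨0, 1, by ring⟩

lemma NR.scale {c a t : K} (ht : t ≠ 0) (h : NR c a) : NR (c * t ^ 2) a := by
  obtain ⟨x, y, rfl⟩ := h
  exact ⟨x, y / t, by field_simp⟩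

lemma NR.symm [NeZero (2 : K)] {c a : K} (ha : a ≠ 0) (h : NR c a) : NR a c := by
  obtain ⟨x, y, h⟩ := h
  have h2 : (2 : K) ≠ 0 := NeZero.ne 2
  by_cases hy : y = 0
  · subst hy
    have h' : a = x ^ 2 := by rw [h]; ring
    have hx : x ≠ 0 := by rintro rfl; exact ha (by rw [h']; ring)
    subst h'
    exact ⟨(c + 1) / 2, (c - 1) / (2 * x), by field_simp; ring⟩
  · refine ⟨x / y, 1 / y, ?_⟩
    rw [h]; field_simp; ring
end field

variable {p : ℕ} [hp : Fact p.Prime]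

lemma decomp (a : ℚ_[p]) (ha : a ≠ 0) : ∃ u : ℤ_[p], IsUnit u ∧ ∃ t : ℚ_[p], t ≠ 0 ∧
    (a = u * t ^ 2 ∨ a = p * u * t ^ 2) := by
  have hp0 : (p : ℚ_[p]) ≠ 0 := by exact_mod_cast hp.out.ne_zero
  have hn : ‖a * (p : ℚ_[p]) ^ (-a.valuation)‖ = 1 := by
    rw [norm_mul, Padic.norm_eq_zpow_neg_valuation ha, Padic.norm_p_zpow, ← zpow_add₀]
    · simp
    · exact_mod_cast hp.out.ne_zero
  have hau : a = (a * (p : ℚ_[p]) ^ (-a.valuation)) * (p : ℚ_[p]) ^ a.valuation := by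
    rw [mul_assoc, ← zpow_add₀ hp0]; simp
  refine ⟨⟨_, hn.le⟩, PadicInt.isUnit_iff.2 hn, ?_⟩
  rcases Int.even_or_odd' a.valuation with ⟨k, hk | hk⟩
  · refine ⟨(p : ℚ_[p]) ^ k, zpow_ne_zero _ hp0, Or.inl ?_⟩
    refine hau.trans ?_
    congr 1
    rw [hk, mul_comm, zpow_mul]; norm_cast
  · refine ⟨(p : ℚ_[p]) ^ k, zpow_ne_zero _ hp0, Or.inr ?_⟩
    refine hau.trans ?_
    have : (p : ℚ_[p]) ^ a.valuation = p * ((p : ℚ_[p]) ^ k) ^ 2 := by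
      rw [hk, zpow_add₀ hp0, mul_comm 2 k, zpow_mul, zpow_one, mul_comm]; norm_cast
    rw [this]
    show _ = p * (a * (p : ℚ_[p]) ^ (-a.valuation)) * _
    ring

/-- Sufficient condition on the norm group of `ℚ_p(√c)`. -/
def Good (c : ℚ_[p]) : Prop :=
  (∀ u : ℤ_[p], IsUnit u → NR c (u : ℚ_[p])) ∨
  ((∃ w : ℤ_[p], IsUnit w ∧ NR c ((p : ℚ_[p]) * w)) ∧
    ∀ u v : ℤ_[p], IsUnit u → IsUnit v →
      NR c (u : ℚ_[p]) ∨ NR c (v : ℚ_[p]) ∨ NR c ((u * v : ℤ_[p]) : ℚ_[p]))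

lemma core {c : ℚ_[p]} (h : Good c) (a b : ℚ_[p]) (ha : a ≠ 0) (hb : b ≠ 0) :
    NR c a ∨ NR c b ∨ NR c (a * b) := by
  rcases h with h | ⟨⟨w, hw, hpw⟩, h⟩
  · obtain ⟨u, hu, t, ht, rfl | rfl⟩ := decomp a ha
    · exact Or.inl ((h u hu).mul (NR.sq _ _))
    obtain ⟨v, hv, s, hs, rfl | rfl⟩ := decomp b hb
    · exact Or.inr (Or.inl ((h v hv).mul (NR.sq _ _)))
    refine Or.inr (Or.inr ?_)
    have := (h (u * v) (hu.mul hv)).mul (NR.sq c (p * t * s))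
    convert this using 1
    push_cast; ring
  · have key : ∀ a : ℚ_[p], a ≠ 0 → ∃ u : ℤ_[p], IsUnit u ∧ ∃ g, NR c g ∧ a = u * g := by
      intro a ha
      obtain ⟨u, hu, t, ht, rfl | rfl⟩ := decomp a ha
      · exact ⟨u, hu, _, NR.sq c t, rfl⟩
      · obtain ⟨w', hw'⟩ := hw.exists_right_inv
        refine ⟨u * w', hu.mul (IsUnit.of_mul_eq_one w (by rw [mul_comm]; exact hw')), _,
          hpw.mul (NR.sq c t), ?_⟩
        have : (w : ℚ_[p]) * w' = 1 := by rw [← PadicInt.coe_mul, hw', PadicInt.coe_one]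
        push_cast
        linear_combination (-(p : ℚ_[p]) * u * t ^ 2) * this
    obtain ⟨u, hu, g, hg, rfl⟩ := key a ha
    obtain ⟨v, hv, k, hk, rfl⟩ := key b hb
    rcases h u v hu hv with h | h | h
    · exact Or.inl (h.mul hg)
    · exact Or.inr (Or.inl (h.mul hk))
    · refine Or.inr (Or.inr ?_)
      convert h.mul (hg.mul hk) using 1
      push_cast; ring

lemma hensel_sq (u w : ℤ_[p]) (h : ‖w ^ 2 - u‖ < ‖2 * w‖ ^ 2) : ∃ z : ℤ_[p], z ^ 2 = u := by
  have := hensels_lemma (p := p) (F := (Polynomial.X ^ 2 - Polynomial.C u : Polynomial ℤ_[p]))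
    (a := w) (by simpa [one_add_one_eq_two] using h)
  obtain ⟨z, hz, -⟩ := this
  exact ⟨z, by simpa [sub_eq_zero] using hz⟩

lemma toZMod_eq_zero (x : ℤ_[p]) : PadicInt.toZMod x = 0 ↔ ¬ IsUnit x := by
  rw [← RingHom.mem_ker, PadicInt.ker_toZMod]; rfl

lemma sq_of_odd (hodd : p ≠ 2) (u : ℤ_[p]) (hu : IsUnit u)
    (h : IsSquare (PadicInt.toZMod u)) : ∃ z : ℤ_[p], z ^ 2 = u := by
  obtain ⟨r, hr⟩ := h
  obtain ⟨w, rfl⟩ := ZMod.ringHom_surjective (PadicInt.toZMod (p := p)) r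
  have hw : IsUnit w := by
    by_contra hw
    rw [(toZMod_eq_zero w).2 hw, mul_zero, toZMod_eq_zero] at hr
    exact hr hu
  have h2 : IsUnit (2 : ℤ_[p]) := by
    by_contra h2
    rw [PadicInt.not_isUnit_iff, PadicInt.norm_lt_one_iff_dvd] at h2
    have h3 := (PadicInt.norm_lt_one_iff_dvd (p := p) ((2 : ℤ) : ℤ_[p])).2 (by exact_mod_cast h2)
    rw [PadicInt.norm_intCast_lt_one_iff] at h3
    have h4 : p ∣ 2 := by exact_mod_cast h3
    exact hodd ((Nat.prime_dvd_prime_iff_eq hp.out Nat.prime_two).1 h4)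
  apply hensel_sq u w
  rw [PadicInt.isUnit_iff.1 (h2.mul hw), one_pow, ← PadicInt.not_isUnit_iff, ← toZMod_eq_zero]
  rw [map_sub, map_pow, hr]; ring

lemma good_odd_unit (hodd : p ≠ 2) (c : ℤ_[p]) (hc : IsUnit c) : Good (c : ℚ_[p]) := by
  left
  intro u hu
  have hcard : Fintype.card (ZMod p) % 2 = 1 := by
    rw [ZMod.card]; exact (hp.out.eq_two_or_odd).resolve_left hodd
  set γ := PadicInt.toZMod c with hγ
  have hγ0 : γ ≠ 0 := fun h => (toZMod_eq_zero c).1 h hc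
  obtain ⟨r, s, hrs⟩ := FiniteField.exists_root_sum_quadratic
    (f := (Polynomial.X ^ 2 - Polynomial.C (PadicInt.toZMod u) : Polynomial (ZMod p)))
    (g := (Polynomial.C (-γ) * Polynomial.X ^ 2 : Polynomial (ZMod p)))
    (Polynomial.degree_X_pow_sub_C (by decide) _)
    (Polynomial.degree_C_mul_X_pow 2 (neg_ne_zero.2 hγ0)) hcard
  simp at hrs
  obtain ⟨x, rfl⟩ := ZMod.ringHom_surjective (PadicInt.toZMod (p := p)) r
  obtain ⟨y, rfl⟩ := ZMod.ringHom_surjective (PadicInt.toZMod (p := p)) s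
  by_cases hx : IsUnit x
  · have e : PadicInt.toZMod (u + c * y ^ 2) = PadicInt.toZMod x * PadicInt.toZMod x := by
      simp only [map_add, map_mul, map_pow]
      linear_combination -hrs
    have hun : IsUnit (u + c * y ^ 2) := by
      by_contra hn
      rw [(toZMod_eq_zero _).2 hn, ← map_mul] at e
      exact (toZMod_eq_zero _).1 e.symm (hx.mul hx)
    obtain ⟨z, hz⟩ := sq_of_odd hodd _ hun ⟨_, e⟩
    refine ⟨z, y, ?_⟩
    have : u = z ^ 2 - c * y ^ 2 := by rw [hz]; ring
    exact_mod_cast congrArg (fun t : ℤ_[p] => (t : ℚ_[p])) this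
  · obtain ⟨d, hd⟩ := hc.exists_right_inv
    have hx0 := (toZMod_eq_zero x).2 hx
    have hd' : γ * PadicInt.toZMod d = 1 := by rw [hγ, ← map_mul, hd, map_one]
    have hdu : IsUnit d := IsUnit.of_mul_eq_one c (by rw [mul_comm]; exact hd)
    have e : PadicInt.toZMod (-u * d) = PadicInt.toZMod y * PadicInt.toZMod y := by
      simp only [map_neg, map_mul]
      rw [hx0] at hrs
      linear_combination PadicInt.toZMod d * hrs + PadicInt.toZMod y ^ 2 * hd'
    obtain ⟨z, hz⟩ := sq_of_odd hodd _ (hu.neg.mul hdu) ⟨_, e⟩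
    refine ⟨0, z, ?_⟩
    have : u = 0 ^ 2 - c * z ^ 2 := by rw [hz]; linear_combination -u * hd
    exact_mod_cast congrArg (fun t : ℤ_[p] => (t : ℚ_[p])) this

lemma good_odd_ram (hodd : p ≠ 2) (c : ℤ_[p]) (hc : IsUnit c) : Good ((p : ℚ_[p]) * (c : ℚ_[p])) := by
  right
  refine ⟨⟨-c, hc.neg, ?_⟩, ?_⟩
  · convert NR.neg ((p : ℚ_[p]) * (c : ℚ_[p])) using 1
    push_cast; ring
  intro u v hu hv
  have fin : ∀ w : ℤ_[p], IsUnit w → IsSquare (PadicInt.toZMod w) →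
      NR ((p : ℚ_[p]) * (c : ℚ_[p])) (w : ℚ_[p]) := by
    intro w hw h
    obtain ⟨z, rfl⟩ := sq_of_odd hodd w hw h
    push_cast
    exact NR.sq _ _
  by_cases h1 : IsSquare (PadicInt.toZMod u)
  · exact Or.inl (fin u hu h1)
  by_cases h2 : IsSquare (PadicInt.toZMod v)
  · exact Or.inr (Or.inl (fin v hv h2))
  refine Or.inr (Or.inr (fin _ (hu.mul hv) ?_))
  have h0 : PadicInt.toZMod (u * v) ≠ 0 := fun h => (toZMod_eq_zero _).1 h (hu.mul hv)
  rw [← quadraticChar_one_iff_isSquare h0, map_mul, map_mul,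
    quadraticChar_neg_one_iff_not_isSquare.2 h1, quadraticChar_neg_one_iff_not_isSquare.2 h2]
  norm_num

/-! The prime 2 -/

/-- Reduction mod 8. -/
noncomputable def m8 : ℤ_[2] →+* ZMod 8 := PadicInt.toZModPow (p := 2) 3

lemma m8_eq_zero (x : ℤ_[2]) : m8 x = 0 ↔ ∃ k, x = 8 * k := by
  have h : m8 x = 0 ↔ x ∈ RingHom.ker (PadicInt.toZModPow (p := 2) 3) := Iff.rfl
  rw [h, PadicInt.ker_toZModPow, Ideal.mem_span_singleton]
  norm_num [Dvd.dvd]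

lemma norm_eight_mul (k : ℤ_[2]) : ‖8 * k‖ ≤ 1 / 8 := by
  have h := (PadicInt.norm_le_pow_iff_mem_span_pow (p := 2) (8 * k) 3).2
    (Ideal.mem_span_singleton.2 ⟨k, by norm_num⟩)
  norm_num at h ⊢
  exact h

lemma isUnit_of_m8 (x : ℤ_[2]) (h : m8 x * m8 x = 1) : IsUnit x := by
  by_contra hx
  rw [PadicInt.not_isUnit_iff, PadicInt.norm_lt_one_iff_dvd] at hx
  obtain ⟨y, rfl⟩ := hx
  rw [map_mul] at h
  have h2 : m8 ((2 : ℕ) : ℤ_[2]) = 2 := map_natCast m8 2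
  rw [h2] at h
  generalize m8 y = r at h
  revert r; decide

lemma m8_of_isUnit (x : ℤ_[2]) (h : IsUnit x) : m8 x * m8 x = 1 := by
  obtain ⟨y, hy⟩ := h.exists_right_inv
  have : m8 x * m8 y = 1 := by rw [← map_mul, hy, map_one]
  generalize m8 x = r at this ⊢
  generalize m8 y = s at this
  revert r s; decide

lemma sq_two (u : ℤ_[2]) (h : m8 u = 1) : ∃ z : ℤ_[2], z ^ 2 = u := by
  apply hensel_sq u 1
  obtain ⟨k, hk⟩ := (m8_eq_zero (1 ^ 2 - u)).1 (by rw [map_sub, h]; simp)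
  rw [hk, mul_one]
  have h2 : ‖(2 : ℤ_[2])‖ = 1 / 2 := by
    have := PadicInt.norm_p (p := 2)
    norm_num at this ⊢
    exact this
  rw [h2]
  have := norm_eight_mul k
  linarith

/-- representability mod 8 -/
def rep (γ α : ZMod 8) : Prop := ∃ x y : ZMod 8, x ^ 2 - γ * y ^ 2 = α

instance (γ α : ZMod 8) : Decidable (rep γ α) := by unfold rep; infer_instance

lemma NR_of_rep (c u : ℤ_[2]) (hu : IsUnit u) (h : rep (m8 c) (m8 u)) :
    NR (c : ℚ_[2]) (u : ℚ_[2]) := by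
  obtain ⟨r, s, h⟩ := h
  obtain ⟨x, rfl⟩ := ZMod.ringHom_surjective m8 r
  obtain ⟨y, rfl⟩ := ZMod.ringHom_surjective m8 s
  set n := x ^ 2 - c * y ^ 2 with hn
  have hm : m8 n = m8 u := by rw [hn, ← h]; simp
  have huu := m8_of_isUnit u hu
  have hnu : IsUnit n := isUnit_of_m8 n (by rw [hm]; exact huu)
  obtain ⟨z, hz⟩ := sq_two (u * n) (by rw [map_mul, hm, huu])
  have hN : NR (c : ℚ_[2]) (n : ℚ_[2]) := ⟨x, y, by rw [hn]; push_cast; ring⟩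
  have hn0 : (n : ℚ_[2]) ≠ 0 := fun h => hnu.ne_zero (PadicInt.coe_eq_zero.1 h)
  convert hN.mul (NR.sq (c : ℚ_[2]) ((z : ℚ_[2]) / n)) using 1
  have : (z : ℚ_[2]) ^ 2 = u * n := by exact_mod_cast congrArg (fun t : ℤ_[2] => (t : ℚ_[2])) hz
  rw [div_pow, this]; field_simp

lemma dec1 : ∀ γ α : ZMod 8, (γ = 1 ∨ γ = 5) → α * α = 1 → rep γ α := by decide

lemma dec2 : ∀ γ α β : ZMod 8, (γ = 2 ∨ γ = 6 ∨ γ = 3 ∨ γ = 7) → α * α = 1 → β * β = 1 →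
    rep γ α ∨ rep γ β ∨ rep γ (α * β) := by decide

lemma units_two (c : ℤ_[2]) (h : m8 c = 2 ∨ m8 c = 6 ∨ m8 c = 3 ∨ m8 c = 7)
    (u v : ℤ_[2]) (hu : IsUnit u) (hv : IsUnit v) :
    NR (c : ℚ_[2]) (u : ℚ_[2]) ∨ NR (c : ℚ_[2]) (v : ℚ_[2]) ∨
      NR (c : ℚ_[2]) ((u * v : ℤ_[2]) : ℚ_[2]) := by
  rcases dec2 _ _ _ h (m8_of_isUnit u hu) (m8_of_isUnit v hv) with h | h | h
  · exact Or.inl (NR_of_rep _ _ hu h)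
  · exact Or.inr (Or.inl (NR_of_rep _ _ hv h))
  · exact Or.inr (Or.inr (NR_of_rep _ _ (hu.mul hv) (by rw [map_mul]; exact h)))

lemma good_two_ram (c : ℤ_[2]) (hc : IsUnit c) : Good (((2 : ℕ) : ℚ_[2]) * (c : ℚ_[2])) := by
  right
  refine ⟨⟨-c, hc.neg, ?_⟩, ?_⟩
  · convert NR.neg (((2 : ℕ) : ℚ_[2]) * (c : ℚ_[2])) using 1
    push_cast; ring
  have := units_two (2 * c) (by
    have h := m8_of_isUnit c hc
    have h2 : m8 (2 * c) = 2 * m8 c := by rw [map_mul]; exact congrArg (· * m8 c) (map_ofNat m8 2)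
    rw [h2]
    generalize m8 c = r at h ⊢
    revert r; decide)
  push_cast at this ⊢
  exact this

lemma good_two_unit (c : ℤ_[2]) (hc : IsUnit c) : Good (c : ℚ_[2]) := by
  have h := m8_of_isUnit c hc
  have h' : (m8 c = 1 ∨ m8 c = 5) ∨ (m8 c = 3 ∨ m8 c = 7) := by
    generalize m8 c = r at h ⊢
    revert r; decide
  rcases h' with h' | h'
  · left
    intro u hu
    exact NR_of_rep c u hu (dec1 _ _ h' (m8_of_isUnit u hu))
  · right
    refine ⟨?_, units_two c (Or.inr (Or.inr h'))⟩
    have e3 : m8 3 = 3 := map_ofNat m8 3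
    have e4 : m8 4 = 4 := map_ofNat m8 4
    have e7 : m8 7 = 7 := map_ofNat m8 7
    have hw : ∃ w : ℤ_[2], IsUnit w ∧ 1 - c = 2 * w := by
      rcases h' with h' | h'
      · obtain ⟨k, hk⟩ := (m8_eq_zero (c - 3)).1 (by rw [map_sub, h', e3, sub_self])
        refine ⟨-1 - 4 * k, isUnit_of_m8 _ ?_, by linear_combination -hk⟩
        have : m8 (-1 - 4 * k) = -1 - 4 * m8 k := by rw [map_sub, map_neg, map_mul, e4, map_one]
        rw [this]
        generalize m8 k = r
        revert r; decide
      · obtain ⟨k, hk⟩ := (m8_eq_zero (c - 7)).1 (by rw [map_sub, h', e7, sub_self])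
        refine ⟨-3 - 4 * k, isUnit_of_m8 _ ?_, by linear_combination -hk⟩
        have : m8 (-3 - 4 * k) = -3 - 4 * m8 k := by rw [map_sub, map_neg, map_mul, e4, e3]
        rw [this]
        generalize m8 k = r
        revert r; decide
    obtain ⟨w, hwu, hw⟩ := hw
    refine ⟨w, hwu, 1, 1, ?_⟩
    have h3 : (1 : ℚ_[2]) - c = 2 * w := congrArg (fun t : ℤ_[2] => (t : ℚ_[2])) hw
    push_cast
    linear_combination -h3

lemma main (a b c : ℚ_[p]) (ha : a ≠ 0) (hb : b ≠ 0) (hc : c ≠ 0) :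
    NR c a ∨ NR c b ∨ NR c (a * b) := by
  have hunit : ∀ u : ℤ_[p], IsUnit u → Good (u : ℚ_[p]) := by
    by_cases h : p = 2
    · subst h; exact good_two_unit
    · exact good_odd_unit h
  have hram : ∀ u : ℤ_[p], IsUnit u → Good ((p : ℚ_[p]) * (u : ℚ_[p])) := by
    by_cases h : p = 2
    · subst h; exact good_two_ram
    · exact good_odd_ram h
  obtain ⟨u, hu, t, ht, rfl | rfl⟩ := decomp c hc
  · exact (core (hunit u hu) a b ha hb).imp (NR.scale ht) (Or.imp (NR.scale ht) (NR.scale ht))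
  · exact (core (hram u hu) a b ha hb).imp (NR.scale ht) (Or.imp (NR.scale ht) (NR.scale ht))

end PadicNormAux

/-- For every prime `p` and all nonzero `a b c : ℚ_[p]`, `c` is of the form
`x² - a·y²`, or `x² - b·y²`, or `x² - (a·b)·y²` with `x, y ∈ ℚ_[p]`. -/
theorem padic_norm_from_one_of_three (p : ℕ) [Fact p.Prime]
    (a b c : ℚ_[p]) (ha : a ≠ 0) (hb : b ≠ 0) (hc : c ≠ 0) :
    (∃ x y : ℚ_[p], c = x ^ 2 - a * y ^ 2) ∨
    (∃ x y : ℚ_[p], c = x ^ 2 - b * y ^ 2) ∨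
    (∃ x y : ℚ_[p], c = x ^ 2 - (a * b) * y ^ 2) := by

  exact (PadicNormAux.main a b c ha hb hc).imp (PadicNormAux.NR.symm ha)
    (Or.imp (PadicNormAux.NR.symm hb) (PadicNormAux.NR.symm (mul_ne_zero ha hb)))
end

section
/- For every prime number p and all nonzero elements a, b, c of the field ℚ_p of p-adic numbers, there exist x, y, z, t, u, w ∈ ℚ_p such that (x² − a·y²)·(z² − b·t²)·(u² − (a·b)·w²) = c. -/
/-- The solvability predicate for three parameters. -/
def SolvT {L : Type*} [Field L] (a b d c : L) : Prop :=
  ∃ x y z t u w : L, (x ^ 2 - a * y ^ 2) * (z ^ 2 - b * t ^ 2) * (u ^ 2 - d * w ^ 2) = c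

theorem SolvT.swap12 {L : Type*} [Field L] {a b d c : L} (h : SolvT a b d c) : SolvT b a d c := by
  obtain ⟨x, y, z, t, u, w, h⟩ := h
  exact ⟨z, t, x, y, u, w, by rw [← h]; ring⟩

theorem SolvT.swap13 {L : Type*} [Field L] {a b d c : L} (h : SolvT a b d c) : SolvT d b a c := by
  obtain ⟨x, y, z, t, u, w, h⟩ := h
  exact ⟨u, w, z, t, x, y, by rw [← h]; ring⟩

theorem SolvT.of_sq {L : Type*} [Field L] [CharZero L] {a b d c : L} (ha : a ≠ 0)
    (h : IsSquare a) : SolvT a b d c := by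
  obtain ⟨s, rfl⟩ := h
  have hs : s ≠ 0 := by rintro rfl; simp at ha
  refine ⟨(c + 1) / 2, (c - 1) / (2 * s), 1, 0, 1, 0, ?_⟩
  field_simp
  ring

theorem SolvT.of_neg_sq {L : Type*} [Field L] [CharZero L] {a b d c r : L} (ha : a ≠ 0)
    (hr : a * b * d = r ^ 2) (h0 : r ≠ 0)
    (h : IsSquare (-a)) (i j k : Fin 2)
    (hc : IsSquare (c * ((-1) ^ (i : ℕ) * 2 ^ (j : ℕ) * 5 ^ (k : ℕ)))) : SolvT a b d c := by
  obtain ⟨s, hs⟩ := h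
  have hs0 : s ≠ 0 := by rintro rfl; simp at hs; exact ha hs
  have ea : a = -(s ^ 2) := by linear_combination -hs
  subst ea
  -- sums of two squares
  have key : ∀ c' : L, IsSquare (c' * (2 ^ (j : ℕ) * 5 ^ (k : ℕ))) →
      ∃ x y : L, x ^ 2 + s ^ 2 * y ^ 2 = c' := by
    rintro c' ⟨m, hm⟩
    fin_cases j <;> fin_cases k <;> simp at hm
    · exact ⟨m, 0, by rw [hm]; ring⟩
    · refine ⟨m / 5, 2 * m / (5 * s), ?_⟩
      field_simp
      linear_combination -5 * hm
    · refine ⟨m / 2, m / (2 * s), ?_⟩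
      field_simp
      linear_combination -2 * hm
    · refine ⟨m / 10, 3 * m / (10 * s), ?_⟩
      field_simp
      linear_combination -10 * hm
  have hbd : b * d = -(r / s) ^ 2 := by
    field_simp
    linear_combination -hr
  fin_cases i
  · obtain ⟨x, y, h⟩ := key c (by simpa using hc)
    exact ⟨x, y, 1, 0, 1, 0, by rw [← h]; ring⟩
  · obtain ⟨x, y, h⟩ := key (-c) (by simpa using hc)
    refine ⟨x * (s / r), y * (s / r), 0, 1, 0, 1, ?_⟩
    have : c = -(x ^ 2 + s ^ 2 * y ^ 2) := by rw [h]; ring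
    rw [this]
    calc _ = (s / r) ^ 2 * (x ^ 2 + s ^ 2 * y ^ 2) * (b * d) := by ring
      _ = _ := by
        rw [hbd]
        field_simp

theorem SolvT.of_gen {L : Type*} [Field L] {a b c : L} (ha : a ≠ 0) (hb : b ≠ 0)
    (e f g : Fin 2)
    (hc : IsSquare (c * (-1) ^ (e : ℕ) * a ^ (f : ℕ) * b ^ (g : ℕ))) : SolvT a b (a * b) c := by
  obtain ⟨s, hs⟩ := hc
  fin_cases e <;> fin_cases f <;> fin_cases g <;> simp at hs
  · exact ⟨s, 0, 1, 0, 1, 0, by rw [hs]; ring⟩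
  · refine ⟨0, s / (a * b), 1, 0, 0, 1, ?_⟩
    field_simp
    first
      | linear_combination -hs
      | linear_combination (a * b) * (-hs)
      | linear_combination b * (-hs)
      | linear_combination (a * b ^ 2) * (-hs)
  · refine ⟨1, 0, 0, s / (a * b), 0, 1, ?_⟩
    field_simp
    first
      | linear_combination -hs
      | linear_combination (a * b) * (-hs)
      | linear_combination b * (-hs)
      | linear_combination (a * b ^ 2) * (-hs)
  · refine ⟨0, s / (a * b), 0, 1, 1, 0, ?_⟩
    field_simp
    first
      | linear_combination -hs
      | linear_combination (a * b) * (-hs)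
      | linear_combination b * (-hs)
      | linear_combination (a * b ^ 2) * (-hs)
  · refine ⟨0, s / (a * b), 0, 1, 0, 1, ?_⟩
    field_simp
    first
      | linear_combination hs
      | linear_combination (a * b) * (hs)
      | linear_combination b * (hs)
      | linear_combination (a * b ^ 2) * (hs)
  · refine ⟨1, 0, 0, s / b, 1, 0, ?_⟩
    field_simp
    first
      | linear_combination hs
      | linear_combination (a * b) * (hs)
      | linear_combination b * (hs)
      | linear_combination (a * b ^ 2) * (hs)
  · refine ⟨0, s / a, 1, 0, 1, 0, ?_⟩
    field_simp
    first
      | linear_combination hs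
      | linear_combination (a * b) * (hs)
      | linear_combination b * (hs)
      | linear_combination (a * b ^ 2) * (hs)
  · refine ⟨1, 0, 1, 0, 0, s / (a * b), ?_⟩
    field_simp
    first
      | linear_combination hs
      | linear_combination (a * b) * (hs)
      | linear_combination b * (hs)
      | linear_combination (a * b ^ 2) * (hs)

theorem padicInt_sq_odd (p : ℕ) [hp : Fact p.Prime] (hp2 : p ≠ 2) (u : ℤ_[p]) (hu : IsUnit u)
    (h : IsSquare (PadicInt.toZMod u)) : IsSquare u := by
  obtain ⟨r, hr⟩ := h
  obtain ⟨r', rfl⟩ := ZMod.ringHom_surjective (PadicInt.toZMod (p := p)) r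
  have h1 : ‖r' ^ 2 - u‖ < 1 := by
    rw [← PadicInt.mem_nonunits, ← IsLocalRing.mem_maximalIdeal, ← PadicInt.ker_toZMod,
      RingHom.mem_ker]
    simp [hr]; ring
  have hun : ‖u‖ = 1 := PadicInt.isUnit_iff.mp hu
  have hrn : ‖r'‖ = 1 := by
    rw [← PadicInt.isUnit_iff]
    by_contra hn
    have : PadicInt.toZMod r' = 0 := by
      rw [← RingHom.mem_ker, PadicInt.ker_toZMod]; exact hn
    rw [this, mul_zero, ← RingHom.mem_ker, PadicInt.ker_toZMod] at hr
    exact hr hu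
  have h2 : ‖(2 : ℤ_[p])‖ = 1 := by
    have := (PadicInt.norm_natCast_eq_one_iff (p := p) (n := 2)).2
      ((Nat.coprime_primes hp.out Nat.prime_two).2 hp2)
    simpa using this
  have := hensels_lemma (F := (Polynomial.X ^ 2 - Polynomial.C u : Polynomial ℤ_[p])) (a := r')
    (by simpa [hrn, h2, one_add_one_eq_two] using h1)
  obtain ⟨z, hz, -⟩ := this
  refine ⟨z, ?_⟩
  simp at hz
  linear_combination -hz

theorem padicInt_sq_two (u : ℤ_[2]) (h : PadicInt.toZModPow 3 u = 1) : IsSquare u := by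
  have h1 : ‖1 - u‖ ≤ (2 : ℝ) ^ (-3 : ℤ) := by
    have := PadicInt.norm_le_pow_iff_mem_span_pow (p := 2) (1 - u) 3
    refine this.2 ?_
    rw [← PadicInt.ker_toZModPow, RingHom.mem_ker]
    simp [h]
  have h2 : ‖(2 : ℤ_[2])‖ = 2⁻¹ := by
    simpa using PadicInt.norm_p (p := 2)
  have := hensels_lemma (F := (Polynomial.X ^ 2 - Polynomial.C u : Polynomial ℤ_[2]))
    (a := (1 : ℤ_[2]))
    (by
      simp [h2, one_add_one_eq_two]
      refine lt_of_le_of_lt h1 ?_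
      norm_num)
  obtain ⟨z, hz, -⟩ := this
  refine ⟨z, ?_⟩
  simp at hz
  linear_combination -hz

/-- Removal of even powers of `p`. -/
theorem padic_decomp (p : ℕ) [hp : Fact p.Prime] (x : ℚ_[p]) (hx : x ≠ 0) :
    ∃ (j : Fin 2) (u : ℤ_[p]) (s : ℚ_[p]), IsUnit u ∧ s ≠ 0 ∧ x * p ^ (j : ℕ) = s ^ 2 * u := by
  have hp0 : (p : ℚ_[p]) ≠ 0 := by exact_mod_cast hp.out.ne_zero
  have hn : ‖x * (p : ℚ_[p]) ^ (-x.valuation)‖ = 1 := by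
    rw [norm_mul, Padic.norm_eq_zpow_neg_valuation hx, Padic.norm_p_zpow, ← zpow_add₀]
    · simp
    · exact_mod_cast hp.out.ne_zero
  obtain ⟨m, hm⟩ := Int.even_or_odd' x.valuation
  have hmem : @IsUnit ℤ_[p] _ ⟨_, hn.le⟩ := PadicInt.isUnit_iff.2 hn
  rcases hm with hm | hm
  · refine ⟨0, ⟨_, hn.le⟩, (p : ℚ_[p]) ^ m, hmem, zpow_ne_zero _ hp0, ?_⟩
    simp only [hm]
    rw [zpow_neg, two_mul, zpow_add₀ hp0]
    field_simp
    simp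
  · refine ⟨1, ⟨_, hn.le⟩, (p : ℚ_[p]) ^ (m + 1), hmem, zpow_ne_zero _ hp0, ?_⟩
    simp only [hm]
    rw [zpow_neg, two_mul, zpow_add₀ hp0, zpow_add₀ hp0, zpow_add₀ hp0]
    simp
    field_simp

theorem padic_class_odd (p : ℕ) [hp : Fact p.Prime] (hp2 : p ≠ 2) :
    ∃ ν : ℚ_[p], ν ≠ 0 ∧ ∀ x : ℚ_[p], x ≠ 0 → ∃ j k : Fin 2,
      IsSquare (x * (p ^ (j : ℕ) * ν ^ (k : ℕ))) := by
  obtain ⟨n, hn⟩ := FiniteField.exists_nonsquare (F := ZMod p) (by rwa [ZMod.ringChar_zmod_n])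
  obtain ⟨n', rfl⟩ := ZMod.ringHom_surjective (PadicInt.toZMod (p := p)) n
  have hnu : IsUnit n' := by
    by_contra h
    apply hn
    have : PadicInt.toZMod n' = 0 := by
      rw [← RingHom.mem_ker, PadicInt.ker_toZMod]; exact h
    rw [this]; exact IsSquare.zero
  refine ⟨n', ?_, fun x hx => ?_⟩
  · simpa using hnu.ne_zero
  obtain ⟨j, u, s, hu, hs, h⟩ := padic_decomp p x hx
  have : ∃ k : Fin 2, IsSquare (u * n' ^ (k : ℕ)) := by
    by_cases hsq : IsSquare (PadicInt.toZMod u)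
    · exact ⟨0, by simpa using padicInt_sq_odd p hp2 u hu hsq⟩
    · refine ⟨1, ?_⟩
      apply padicInt_sq_odd p hp2 _ (by simpa using hu.mul hnu)
      have h1 := quadraticChar_neg_one_iff_not_isSquare.2 hsq
      have h2 := quadraticChar_neg_one_iff_not_isSquare.2 hn
      have hne : PadicInt.toZMod (u * n') ≠ 0 := by
        exact ((hu.mul hnu).map PadicInt.toZMod).ne_zero
      have := (quadraticChar_one_iff_isSquare hne).1 (by rw [map_mul, map_mul, h1, h2]; norm_num)
      simpa using this
  obtain ⟨k, m, hm⟩ := this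
  refine ⟨j, k, s * m, ?_⟩
  have hm' : (u : ℚ_[p]) * (n' : ℚ_[p]) ^ (k : ℕ) = m * m := by exact_mod_cast congrArg (Subtype.val) hm
  linear_combination (n' : ℚ_[p]) ^ (k : ℕ) * h + s ^ 2 * hm'

theorem padic_class_two (x : ℚ_[2]) (hx : x ≠ 0) : ∃ i j k : Fin 2,
      IsSquare (x * ((-1) ^ (i : ℕ) * 2 ^ (j : ℕ) * 5 ^ (k : ℕ))) := by
  obtain ⟨j, u, s, hu, hs, h⟩ := padic_decomp 2 x hx
  have hz : ∀ z : ZMod (2 ^ 3), IsUnit z → ∃ i k : Fin 2, z * ((-1) ^ (i : ℕ) * 5 ^ (k : ℕ)) = 1 := by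
    decide
  obtain ⟨i, k, hik⟩ := hz _ (hu.map (PadicInt.toZModPow 3))
  have h5 : PadicInt.toZModPow (p := 2) 3 5 = 5 := map_ofNat _ 5
  obtain ⟨m, hm⟩ := padicInt_sq_two (u * ((-1) ^ (i : ℕ) * 5 ^ (k : ℕ))) (by
    rw [← hik, map_mul, map_mul, map_pow, map_pow, map_neg, map_one, h5])
  refine ⟨i, j, k, s * m, ?_⟩
  have hm' : (u : ℚ_[2]) * ((-1) ^ (i : ℕ) * 5 ^ (k : ℕ)) = m * m := by
    have := congrArg (Subtype.val) hm
    push_cast at this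
    exact this
  push_cast at h
  linear_combination ((-1) ^ (i : ℕ) * 5 ^ (k : ℕ)) * h + s ^ 2 * hm'

theorem isSquare_of_eq {L : Type*} [Field L] {x y : L} (h : IsSquare x) (e : y = x) :
    IsSquare y := e ▸ h

theorem isSquare_cancel {L : Type*} [Field L] {x y : L} (hy : y ≠ 0) (h : IsSquare (x * y))
    (h' : IsSquare y) : IsSquare x := by
  have := h.div h'
  rwa [mul_div_cancel_right₀ _ hy] at this

theorem solv_odd (p : ℕ) [hp : Fact p.Prime] (hp2 : p ≠ 2) (a b c : ℚ_[p])
    (ha : a ≠ 0) (hb : b ≠ 0) (hc : c ≠ 0) : SolvT a b (a * b) c := by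
  obtain ⟨ν, hν, H⟩ := padic_class_odd p hp2
  have hp0 : (p : ℚ_[p]) ≠ 0 := by exact_mod_cast hp.out.ne_zero
  obtain ⟨a1, a2, hA⟩ := H a ha
  obtain ⟨b1, b2, hB⟩ := H b hb
  obtain ⟨c1, c2, hC⟩ := H c hc
  have comb : ∀ a1 a2 b1 b2 c1 c2 : Fin 2,
      (Even (a1 : ℕ) ∧ Even (a2 : ℕ)) ∨ (Even (b1 : ℕ) ∧ Even (b2 : ℕ)) ∨
      (Even (a1 + b1 : ℕ) ∧ Even (a2 + b2 : ℕ)) ∨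
      ∃ f g : Fin 2, Even (c1 + a1 * f + b1 * g : ℕ) ∧ Even (c2 + a2 * f + b2 * g : ℕ) := by
    decide
  have S : ∀ (x : ℚ_[p]) (m n : ℕ), Even m → Even n → IsSquare (x * (p ^ m * ν ^ n)) →
      IsSquare x := fun x m n hm hn h => isSquare_cancel
        (mul_ne_zero (pow_ne_zero _ hp0) (pow_ne_zero _ hν)) h ((hm.isSquare_pow _).mul (hn.isSquare_pow _))
  rcases comb a1 a2 b1 b2 c1 c2 with ⟨h1, h2⟩ | ⟨h1, h2⟩ | ⟨h1, h2⟩ | ⟨f, g, h1, h2⟩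
  · exact SolvT.of_sq ha (S _ _ _ h1 h2 hA)
  · exact (SolvT.of_sq hb (S _ _ _ h1 h2 hB)).swap12
  · refine (SolvT.of_sq (mul_ne_zero ha hb) (S _ _ _ h1 h2 ?_)).swap13
    refine isSquare_of_eq (hA.mul hB) ?_
    ring
  · refine SolvT.of_gen ha hb 0 f g (S _ _ _ h1 h2 ?_)
    refine isSquare_of_eq ((hC.mul (hA.pow f)).mul (hB.pow g)) ?_
    simp only [Fin.val_zero]
    ring

theorem solv_two (a b c : ℚ_[2])
    (ha : a ≠ 0) (hb : b ≠ 0) (hc : c ≠ 0) : SolvT a b (a * b) c := by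
  obtain ⟨a0, a1, a2, hA⟩ := padic_class_two a ha
  obtain ⟨b0, b1, b2, hB⟩ := padic_class_two b hb
  obtain ⟨c0, c1, c2, hC⟩ := padic_class_two c hc
  have comb : ∀ a1 a2 b1 b2 c1 c2 : Fin 2,
      (Even (a1 : ℕ) ∧ Even (a2 : ℕ)) ∨ (Even (b1 : ℕ) ∧ Even (b2 : ℕ)) ∨
      (Even (a1 + b1 : ℕ) ∧ Even (a2 + b2 : ℕ)) ∨
      ∃ f g : Fin 2, Even (c1 + a1 * f + b1 * g : ℕ) ∧ Even (c2 + a2 * f + b2 * g : ℕ) := by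
    decide
  have S : ∀ (x : ℚ_[2]) (l m n : ℕ), Even m → Even n →
      IsSquare (x * ((-1) ^ l * 2 ^ m * 5 ^ n)) → IsSquare (x * (-1) ^ l) :=
    fun x l m n hm hn h => isSquare_cancel (y := 2 ^ m * 5 ^ n)
      (mul_ne_zero (pow_ne_zero _ two_ne_zero) (pow_ne_zero _ (by norm_num)))
      (isSquare_of_eq h (by ring)) ((hm.isSquare_pow _).mul (hn.isSquare_pow _))
  have T : ∀ (x y z r : ℚ_[2]) (l m n : ℕ), Even m → Even n → x ≠ 0 → x * y * z = r ^ 2 → r ≠ 0 →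
      IsSquare (x * ((-1) ^ l * 2 ^ m * 5 ^ n)) → SolvT x y z c := by
    intro x y z r l m n hm hn hx hr h0 h
    have h' := S x l m n hm hn h
    rcases neg_one_pow_eq_or ℚ_[2] l with e | e
    · rw [e, mul_one] at h'
      exact SolvT.of_sq hx h'
    · rw [e, mul_neg_one] at h'
      exact SolvT.of_neg_sq hx hr h0 h' c0 c1 c2 hC
  have hab := mul_ne_zero ha hb
  rcases comb a1 a2 b1 b2 c1 c2 with ⟨h1, h2⟩ | ⟨h1, h2⟩ | ⟨h1, h2⟩ | ⟨f, g, h1, h2⟩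
  · exact T a b (a * b) (a * b) _ _ _ h1 h2 ha (by ring) hab hA
  · exact (T b a (a * b) (a * b) _ _ _ h1 h2 hb (by ring) hab hB).swap12
  · refine (T (a * b) b a (a * b) (a0 + b0) _ _ h1 h2 hab (by ring) hab ?_).swap13
    refine isSquare_of_eq (hA.mul hB) ?_
    ring
  · have h3 := S (c * a ^ (f : ℕ) * b ^ (g : ℕ)) (c0 + a0 * f + b0 * g) _ _ h1 h2 (by
      refine isSquare_of_eq ((hC.mul (hA.pow f)).mul (hB.pow g)) ?_
      ring)
    rcases neg_one_pow_eq_or ℚ_[2] (c0 + a0 * f + b0 * g : ℕ) with e | e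
    · rw [e] at h3
      refine SolvT.of_gen ha hb 0 f g ?_
      simpa using h3
    · rw [e] at h3
      refine SolvT.of_gen ha hb 1 f g ?_
      simpa using h3

/-- For every prime `p` and all nonzero `a b c : ℚ_[p]`, the product equation
`(x² - a·y²)(z² - b·t²)(u² - (a·b)·w²) = c` has a solution in `ℚ_[p]`. -/
theorem padic_product_equation_solvable (p : ℕ) [Fact p.Prime]
    (a b c : ℚ_[p]) (ha : a ≠ 0) (hb : b ≠ 0) (hc : c ≠ 0) :
    ∃ x y z t u w : ℚ_[p],
      (x ^ 2 - a * y ^ 2) * (z ^ 2 - b * t ^ 2) * (u ^ 2 - (a * b) * w ^ 2) = c := by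
  by_cases hp2 : p = 2
  · subst hp2
    exact solv_two a b c ha hb hc
  · exact solv_odd p hp2 a b c ha hb hc
end

section
/- Let k be a field of characteristic zero and a, b ∈ k nonzero elements such that none of a, b, a·b is a square in k. Let K be a field extension of k of degree 4 containing elements r, s with r² = a and s² = b (so K = k(√a, √b) is a biquadratic extension). If x ∈ k is nonzero and there exists a nonzero ξ ∈ K with N_{K/k}(ξ) = x², then there exist z₁, t₁, z₂, t₂, z₃, t₃ ∈ k such that x = (z₁² − a·t₁²)·(z₂² − b·t₂²)·(z₃² − (a·b)·t₃²), i.e. x is a product of norms from the three quadratic subextensions k(√a), k(√b), k(√(ab)). -/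
/-- An anisotropic binary form. -/
lemma aux_aniso {k : Type*} [Field k] {d : k} (hd : ¬ IsSquare d) {u v : k}
    (h : u ^ 2 - d * v ^ 2 = 0) : u = 0 ∧ v = 0 := by
  by_cases hv : v = 0
  · subst hv
    exact ⟨by simpa using h, rfl⟩
  · exfalso
    apply hd
    refine ⟨u / v, ?_⟩
    field_simp
    linear_combination -h

/-- An element of `k` which is a norm from `K / k(√a)` is a product of norms from
`k(√b)` and `k(√(ab))`. -/
lemma aux_step {k : Type*} [Field k] {a b : k} (hb : b ≠ 0) (hsb : ¬ IsSquare b)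
    {c u0 u1 v0 v1 : k}
    (hc : c = u0 ^ 2 + a * u1 ^ 2 - b * v0 ^ 2 - a * b * v1 ^ 2)
    (h : u0 * u1 = b * (v0 * v1)) :
    ∃ z₂ t₂ z₃ t₃ : k, c = (z₂ ^ 2 - b * t₂ ^ 2) * (z₃ ^ 2 - (a * b) * t₃ ^ 2) := by
  by_cases hD : u1 ^ 2 - b * v1 ^ 2 = 0
  · obtain ⟨rfl, rfl⟩ := aux_aniso hsb hD
    exact ⟨u0, v0, 1, 0, by rw [hc]; ring⟩
  · obtain ⟨p, hp⟩ : ∃ p, p = (v0 * u1 - u0 * v1) / (u1 ^ 2 - b * v1 ^ 2) := ⟨_, rfl⟩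
    have hp' : p * (u1 ^ 2 - b * v1 ^ 2) = v0 * u1 - u0 * v1 := by
      rw [hp]; exact div_mul_cancel₀ _ hD
    have h0 : u0 = p * b * v1 := by
      apply mul_right_cancel₀ hD
      linear_combination u1 * h - b * v1 * hp'
    have h1 : v0 = p * u1 := by
      apply mul_right_cancel₀ hD
      linear_combination v1 * h - u1 * hp'
    refine ⟨b * v1, u1, p, 1 / b, ?_⟩
    rw [hc, h0, h1]
    field_simp
    ring

/-- The purely algebraic heart of the argument. -/
lemma aux_core {k : Type*} [Field k] [CharZero k] {a b : k} (ha : a ≠ 0) (hb : b ≠ 0)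
    (hsb : ¬ IsSquare b) {x : k} (hx : x ≠ 0) {p q m n y0 y1 : k}
    (h0 : y0 = p ^ 2 + a * q ^ 2 - b * m ^ 2 - a * b * n ^ 2)
    (h1 : y1 = 2 * (p * q - b * (m * n)))
    (h : y0 ^ 2 - a * y1 ^ 2 = x ^ 2) :
    ∃ z₁ t₁ z₂ t₂ z₃ t₃ : k,
      x = (z₁ ^ 2 - a * t₁ ^ 2) * (z₂ ^ 2 - b * t₂ ^ 2)
            * (z₃ ^ 2 - (a * b) * t₃ ^ 2) := by
  have h2 : (2 : k) ≠ 0 := two_ne_zero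
  by_cases hw : x + y0 = 0
  · have hy1 : y1 = 0 := by
      have : a * y1 ^ 2 = 0 := by linear_combination (y0 - x) * hw - h
      simpa [ha] using this
    have hpq : p * q = b * (m * n) := by
      apply mul_left_cancel₀ h2
      linear_combination hy1 - h1
    obtain ⟨z₂, t₂, z₃, t₃, hz⟩ := aux_step (a := a) (b := b) (c := -x / a)
      (u0 := q) (u1 := p / a) (v0 := n) (v1 := m / a) hb hsb
      (by field_simp; linear_combination h0 - hw)
      (by field_simp; linear_combination hpq)
    refine ⟨0, 1, z₂, t₂, z₃, t₃, ?_⟩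
    rw [mul_assoc, ← hz]
    field_simp
    ring
  · obtain ⟨z₂, t₂, z₃, t₃, hz⟩ := aux_step (a := a) (b := b) (c := 2 * (x + y0))
      (u0 := (p * (x + y0) - a * q * y1) / x) (u1 := (q * (x + y0) - p * y1) / x)
      (v0 := (m * (x + y0) - a * n * y1) / x) (v1 := (n * (x + y0) - m * y1) / x) hb hsb
      (by
        field_simp
        have e : (x + y0) ^ 2 + a * y1 ^ 2 = 2 * y0 * (x + y0) := by linear_combination -h
        linear_combination ((x + y0) ^ 2 + a * y1 ^ 2) * h0 - 2 * a * y1 * (x + y0) * h1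
          - 2 * (x + y0) * h - y0 * e)
      (by
        field_simp
        have e : (x + y0) ^ 2 + a * y1 ^ 2 = 2 * y0 * (x + y0) := by linear_combination -h
        apply mul_left_cancel₀ h2
        linear_combination -((x + y0) ^ 2 + a * y1 ^ 2) * h1 + 2 * y1 * (x + y0) * h0 + y1 * e)
    refine ⟨(x + y0) / (2 * (x + y0)), y1 / (2 * (x + y0)), z₂, t₂, z₃, t₃, ?_⟩
    rw [mul_assoc, ← hz]
    field_simp
    linear_combination -h

/-- `1, r, s, rs` are linearly independent. -/
lemma aux_indep {k K : Type*} [Field k] [CharZero k] [Field K] [Algebra k K]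
    {a b : k} (hb : b ≠ 0)
    (hsa : ¬ IsSquare a) (hsb : ¬ IsSquare b) (hsab : ¬ IsSquare (a * b))
    {r s : K} (hr : r ^ 2 = algebraMap k K a) (hs : s ^ 2 = algebraMap k K b)
    {p q m n : k} (h : algebraMap k K p + algebraMap k K q * r + algebraMap k K m * s
      + algebraMap k K n * (r * s) = 0) : p = 0 ∧ q = 0 ∧ m = 0 ∧ n = 0 := by
  have inj := (algebraMap k K).injective
  have lin : ∀ {u v : k}, algebraMap k K u + algebraMap k K v * r = 0 → u = 0 ∧ v = 0 := by
    intro u v huv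
    apply aux_aniso hsa
    apply inj
    simp only [map_sub, map_mul, map_pow, map_zero, ← hr]
    linear_combination (algebraMap k K u - algebraMap k K v * r) * huv
  by_cases hN : m ^ 2 - a * n ^ 2 = 0
  · obtain ⟨rfl, rfl⟩ := aux_aniso hsa hN
    obtain ⟨rfl, rfl⟩ := lin (u := p) (v := q) (by simpa using h)
    simp
  · exfalso
    obtain ⟨N, hNd⟩ : ∃ N, N = m ^ 2 - a * n ^ 2 := ⟨_, rfl⟩
    rw [← hNd] at hN
    -- `N s = -(e + f r)`
    obtain ⟨e, he⟩ : ∃ e, e = p * m - a * q * n := ⟨_, rfl⟩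
    obtain ⟨f, hf⟩ : ∃ f, f = q * m - p * n := ⟨_, rfl⟩
    have hs1 : algebraMap k K N * s = -(algebraMap k K e + algebraMap k K f * r) := by
      rw [hNd, he, hf]
      simp only [map_sub, map_mul, map_pow, ← hr]
      linear_combination (algebraMap k K m - algebraMap k K n * r) * h
    obtain ⟨h3, h4⟩ := lin (u := e ^ 2 + a * f ^ 2 - b * N ^ 2) (v := 2 * (e * f)) (by
      simp only [map_sub, map_add, map_mul, map_pow, map_ofNat, ← hr, ← hs]
      linear_combination (-algebraMap k K N * s + algebraMap k K e + algebraMap k K f * r) * hs1)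
    have h5 : e = 0 ∨ f = 0 := by simpa using h4
    rcases h5 with h5 | h5
    · apply hsab
      refine ⟨a * f / N, ?_⟩
      rw [h5] at h3
      field_simp
      linear_combination -a * h3
    · apply hsb
      refine ⟨e / N, ?_⟩
      rw [h5] at h3
      field_simp
      linear_combination -h3

/-- The explicit norm form of a biquadratic extension. -/
lemma aux_norm {k K : Type*} [Field k] [CharZero k] [Field K] [Algebra k K]
    {a b : k} (hb : b ≠ 0)
    (hsa : ¬ IsSquare a) (hsb : ¬ IsSquare b) (hsab : ¬ IsSquare (a * b))
    (hdim : Module.finrank k K = 4)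
    {r s : K} (hr : r ^ 2 = algebraMap k K a) (hs : s ^ 2 = algebraMap k K b) (ξ : K) :
    ∃ p q m n : k, Algebra.norm k ξ =
      (p ^ 2 + a * q ^ 2 - b * m ^ 2 - a * b * n ^ 2) ^ 2
        - a * (2 * (p * q - b * (m * n))) ^ 2 := by
  have hli : LinearIndependent k ![1, r, s, r * s] := by
    rw [Fintype.linearIndependent_iff]
    intro g hg
    simp only [Fin.sum_univ_four, Algebra.smul_def] at hg
    obtain ⟨h0, h1, h2, h3⟩ := aux_indep (p := g 0) (q := g 1) (m := g 2) (n := g 3)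
      hb hsa hsb hsab hr hs (by simpa using hg)
    intro i
    fin_cases i <;> assumption
  let B := basisOfLinearIndependentOfCardEqFinrank hli (by simp [hdim])
  have hB : ∀ i, B i = ![1, r, s, r * s] i := fun i => by simp [B]
  have hsum := B.sum_repr ξ
  obtain ⟨p, hp⟩ : ∃ p, p = B.repr ξ 0 := ⟨_, rfl⟩
  obtain ⟨q, hq⟩ : ∃ p, p = B.repr ξ 1 := ⟨_, rfl⟩
  obtain ⟨m, hm⟩ : ∃ p, p = B.repr ξ 2 := ⟨_, rfl⟩
  obtain ⟨n, hn⟩ : ∃ p, p = B.repr ξ 3 := ⟨_, rfl⟩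
  have hξ : ξ = algebraMap k K p + algebraMap k K q * r + algebraMap k K m * s
      + algebraMap k K n * (r * s) := by
    rw [← hsum, hp, hq, hm, hn]
    simp [Fin.sum_univ_four, hB, Algebra.smul_def]
  refine ⟨p, q, m, n, ?_⟩
  have hM : Algebra.leftMulMatrix B ξ =
      !![p, a * q, b * m, a * b * n; q, p, b * n, b * m; m, a * n, p, a * q; n, m, q, p] := by
    have key : ∀ j (c : Fin 4 → k), ξ * B j = ∑ i, c i • B i →
        ∀ i, Algebra.leftMulMatrix B ξ i j = c i := by
      intro j c hc i
      rw [Algebra.leftMulMatrix_eq_repr_mul, hc]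
      exact congrFun (B.repr_sum_self c) i
    ext i j
    fin_cases j
    · refine (key 0 ![p, q, m, n] ?_ i).trans ?_
      · simp [Fin.sum_univ_four, hB, Algebra.smul_def, hξ]
      · fin_cases i <;> rfl
    · refine (key 1 ![a * q, p, a * n, m] ?_ i).trans ?_
      · simp [Fin.sum_univ_four, hB, Algebra.smul_def, hξ, ← hr]
        ring
      · fin_cases i <;> rfl
    · refine (key 2 ![b * m, b * n, p, q] ?_ i).trans ?_
      · simp [Fin.sum_univ_four, hB, Algebra.smul_def, hξ, ← hs]
        ring
      · fin_cases i <;> rfl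
    · refine (key 3 ![a * b * n, b * m, a * q, p] ?_ i).trans ?_
      · simp [Fin.sum_univ_four, hB, Algebra.smul_def, hξ, ← hr, ← hs]
        ring
      · fin_cases i <;> rfl
  rw [Algebra.norm_eq_matrix_det B, hM]
  simp [Matrix.det_succ_row_zero, Fin.sum_univ_succ, Fin.succAbove]
  ring

/-- If `x²` is a norm from the biquadratic extension `K = k(√a, √b)` (with `x ≠ 0`),
then `x` is a product of norms from the three quadratic subextensions
`k(√a)`, `k(√b)`, `k(√(ab))`. -/
theorem product_of_quadratic_norms_of_sq_is_biquadratic_norm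
    (k K : Type*) [Field k] [CharZero k] [Field K] [Algebra k K]
    (a b : k) (ha : a ≠ 0) (hb : b ≠ 0)
    (hsa : ¬ IsSquare a) (hsb : ¬ IsSquare b) (hsab : ¬ IsSquare (a * b))
    (hdim : Module.finrank k K = 4)
    (r s : K) (hr : r ^ 2 = algebraMap k K a) (hs : s ^ 2 = algebraMap k K b)
    (x : k) (hx : x ≠ 0)
    (ξ : K) (hξ : ξ ≠ 0) (hnorm : Algebra.norm k ξ = x ^ 2) :
    ∃ z₁ t₁ z₂ t₂ z₃ t₃ : k,
      x = (z₁ ^ 2 - a * t₁ ^ 2) * (z₂ ^ 2 - b * t₂ ^ 2)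
            * (z₃ ^ 2 - (a * b) * t₃ ^ 2) := by
  obtain ⟨p, q, m, n, h⟩ := aux_norm hb hsa hsb hsab hdim hr hs ξ
  exact aux_core ha hb hsb hx rfl rfl (h.symm.trans hnorm)
end

section
/- Let k be a field of characteristic zero and a, b ∈ k nonzero elements such that none of a, b, a·b is a square in k. Let K be a field extension of k of degree 4 containing elements r, s with r² = a and s² = b. If x ∈ k is nonzero and can be written as x = (z₁² − a·t₁²)·(z₂² − b·t₂²)·(z₃² − (a·b)·t₃²) with z₁, t₁, z₂, t₂, z₃, t₃ ∈ k, then there exists ξ ∈ K with N_{K/k}(ξ) = x². -/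
open Polynomial IntermediateField in
/-- For `w = z + t * r` with `r ^ 2 = c` a nonsquare in the base field and `[K : k] = 4`,
the norm of `w` is the square of the quadratic norm. -/
lemma norm_quadratic_element {k K : Type*} [Field k] [Field K] [Algebra k K]
    (hdim : Module.finrank k K = 4) (c : k) (hc : ¬ IsSquare c) (r : K)
    (hr : r ^ 2 = algebraMap k K c) (z t : k) :
    Algebra.norm k (algebraMap k K z + algebraMap k K t * r) = (z ^ 2 - c * t ^ 2) ^ 2 := by
  by_cases ht : t = 0
  · subst ht
    simp only [map_zero, zero_mul, add_zero, Algebra.norm_algebraMap, hdim]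
    ring
  have hfin : FiniteDimensional k K := Module.finite_of_finrank_pos (by omega)
  set w : K := algebraMap k K z + algebraMap k K t * r with hw
  set d : k := z ^ 2 - c * t ^ 2 with hd
  let p : k[X] := X ^ 2 + (C (-(2 * z)) * X + C d)
  have hdeg : (C (-(2 * z)) * X + C d : k[X]).degree < ((2 : ℕ) : WithBot ℕ) :=
    lt_of_le_of_lt degree_linear_le (by norm_num)
  have hmon : p.Monic := monic_X_pow_add hdeg
  have hnat : p.natDegree = 2 := by
    have : p.degree = ((2 : ℕ) : WithBot ℕ) := by
      simp only [p]
      rw [degree_add_eq_left_of_degree_lt] <;> rw [degree_X_pow]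
      exact hdeg
    exact natDegree_eq_of_degree_eq_some this
  have hirr : Irreducible p := by
    rw [hmon.irreducible_iff_roots_eq_zero_of_degree_le_three (by omega) (by omega)]
    rw [Multiset.eq_zero_iff_forall_notMem]
    intro y hy
    have hy' := (mem_roots'.1 hy).2
    simp only [p, IsRoot.def, eval_add, eval_pow, eval_mul, eval_X, eval_C, hd] at hy'
    apply hc
    refine ⟨(y - z) / t, ?_⟩
    field_simp
    linear_combination -hy'
  have hroot : aeval w p = 0 := by
    simp only [p, map_add, map_mul, map_pow, aeval_X, aeval_C, hd, hw, map_neg, map_sub,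
      map_ofNat]
    linear_combination (algebraMap k K t) ^ 2 * hr
  have hmin : minpoly k w = p := (minpoly.eq_of_irreducible_of_monic hirr hroot hmon).symm
  have hint : IsIntegral k w := IsIntegral.of_finite k w
  have h2 : Module.finrank k k⟮w⟯ = 2 := by
    rw [adjoin.finrank hint, hmin, hnat]
  have h2' : Module.finrank k⟮w⟯ K = 2 := by
    have := Module.finrank_mul_finrank k k⟮w⟯ K
    rw [h2, hdim] at this
    omega
  rw [Algebra.norm_eq_norm_adjoin, h2']
  congr 1
  rw [← adjoin.powerBasis_gen hint, Algebra.PowerBasis.norm_gen_eq_coeff_zero_minpoly,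
    adjoin.powerBasis_gen hint, minpoly_gen, hmin, adjoin.powerBasis_dim, hmin, hnat]
  simp [p]

/-- If `x` is a product of norms from the three quadratic subextensions
`k(√a)`, `k(√b)`, `k(√(ab))` of the biquadratic extension `K = k(√a, √b)`,
then `x²` is a norm from `K`. -/
theorem sq_is_biquadratic_norm_of_product_of_quadratic_norms
    (k K : Type*) [Field k] [CharZero k] [Field K] [Algebra k K]
    (a b : k) (ha : a ≠ 0) (hb : b ≠ 0)
    (hsa : ¬ IsSquare a) (hsb : ¬ IsSquare b) (hsab : ¬ IsSquare (a * b))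
    (hdim : Module.finrank k K = 4)
    (r s : K) (hr : r ^ 2 = algebraMap k K a) (hs : s ^ 2 = algebraMap k K b)
    (x : k) (hx : x ≠ 0)
    (z₁ t₁ z₂ t₂ z₃ t₃ : k)
    (hprod : x = (z₁ ^ 2 - a * t₁ ^ 2) * (z₂ ^ 2 - b * t₂ ^ 2)
            * (z₃ ^ 2 - (a * b) * t₃ ^ 2)) :
    ∃ ξ : K, Algebra.norm k ξ = x ^ 2 := by
  refine ⟨(algebraMap k K z₁ + algebraMap k K t₁ * r) * (algebraMap k K z₂ + algebraMap k K t₂ * s)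
    * (algebraMap k K z₃ + algebraMap k K t₃ * (r * s)), ?_⟩
  rw [map_mul, map_mul, norm_quadratic_element hdim a hsa r hr,
    norm_quadratic_element hdim b hsb s hs,
    norm_quadratic_element hdim (a * b) hsab (r * s) (by rw [mul_pow, hr, hs, map_mul]), hprod]
  ring
end

section
/- The equation (x² − 13·y²)·(z² − 17·t²)·(u² − 221·w²) = 5 is a counterexample to the Hasse principle: it has a solution with x, y, z, t, u, w ∈ ℝ, and for every prime p it has a solution with x, y, z, t, u, w ∈ ℚ_p, but it has no solution with x, y, z, t, u, w ∈ ℚ. -/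
instance fact_prime_seventeen : Fact (Nat.Prime 17) := ⟨by norm_num⟩

/-- Legendre symbol at 17 of the prime-to-17 part. -/
def psi (n : ℕ) : ℤ := legendreSym 17 ((ordCompl[17] n : ℕ) : ℤ)

lemma psi_mul (m n : ℕ) : psi (m * n) = psi m * psi n := by
  unfold psi
  rw [Nat.ordCompl_mul, Nat.cast_mul, legendreSym.mul]

lemma psi_one : psi 1 = 1 := by simp [psi]

lemma psi_seventeen : psi 17 = 1 := by
  have h := Nat.ordCompl_self_pow (p := 17) (k := 1) (by norm_num)
  rw [pow_one] at h
  unfold psi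
  rw [h]
  simp

lemma psi_pow (m k : ℕ) : psi (m ^ k) = psi m ^ k := by
  induction k with
  | zero => simp [psi_one]
  | succ k ih => rw [pow_succ, psi_mul, ih, pow_succ]

lemma psi_of_not_dvd (n : ℕ) (h : ¬ 17 ∣ n) : psi n = legendreSym 17 (n : ℤ) := by
  unfold psi
  rw [(Nat.ordCompl_eq_self_iff_zero_or_not_dvd n (by norm_num)).2 (Or.inr h)]

lemma psi_sq (n : ℕ) (h : n ≠ 0) : psi n ^ 2 = 1 := by
  unfold psi
  apply legendreSym.sq_one
  have := Nat.not_dvd_ordCompl (p := 17) (by norm_num) h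
  rwa [Int.cast_natCast, Ne, ZMod.natCast_eq_zero_iff]

lemma leg_neg (a : ℤ) : legendreSym 17 (-a) = legendreSym 17 a := by
  rw [legendreSym.at_neg (by norm_num)]
  have : ZMod.χ₄ ((17 : ℕ) : ZMod 4) = 1 := by decide
  rw [this, one_mul]

lemma leg_natAbs (a : ℤ) : legendreSym 17 (a.natAbs : ℤ) = legendreSym 17 a := by
  rcases Int.natAbs_eq a with h | h
  · rw [← h]
  · conv_rhs => rw [h]
    rw [leg_neg]

lemma psi_natAbs (a : ℤ) (h : ¬ (17 : ℤ) ∣ a) : psi a.natAbs = legendreSym 17 a := by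
  rw [psi_of_not_dvd, leg_natAbs]
  intro h'
  exact h (Int.natCast_dvd.2 h')


lemma psi_eq_one (n : ℕ) (hn : n ≠ 0)
    (h : ∀ p : ℕ, p.Prime → Odd (n.factorization p) → psi p = 1) : psi n = 1 := by
  rw [Nat.multiplicative_factorization psi (fun x y _ => psi_mul x y) psi_one hn]
  apply Finset.prod_eq_one
  intro p hp
  have hpp : p.Prime := Nat.prime_of_mem_primeFactors hp
  simp only [psi_pow]
  rcases Nat.even_or_odd (n.factorization p) with he | ho
  · obtain ⟨k, hk⟩ := he
    rw [hk, ← two_mul, pow_mul, psi_sq p hpp.ne_zero, one_pow]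
  · rw [h p hpp ho, one_pow]

lemma even_val (p : ℕ) [Fact p.Prime] (a : ℤ) (ha : legendreSym p a = -1) (N : ℕ) :
    ∀ x y : ℤ, (x ^ 2 - a * y ^ 2).natAbs ≤ N → x ^ 2 - a * y ^ 2 ≠ 0 →
      Even ((x ^ 2 - a * y ^ 2).natAbs.factorization p) := by
  have hp : p.Prime := Fact.out
  induction N with
  | zero =>
    intro x y h h0
    exact absurd (Int.natAbs_eq_zero.1 (Nat.le_zero.1 h)) h0
  | succ N ih =>
    intro x y h h0
    by_cases hd : (p : ℤ) ∣ x ^ 2 - a * y ^ 2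
    · obtain ⟨⟨x', rfl⟩, ⟨y', rfl⟩⟩ := legendreSym.prime_dvd_of_eq_neg_one ha hd
      have e : ((p : ℤ) * x') ^ 2 - a * (p * y') ^ 2 = p ^ 2 * (x' ^ 2 - a * y' ^ 2) := by ring
      rw [e] at h h0 ⊢
      have h0' : x' ^ 2 - a * y' ^ 2 ≠ 0 := right_ne_zero_of_mul h0
      have h1 : (x' ^ 2 - a * y' ^ 2).natAbs ≠ 0 := Int.natAbs_ne_zero.2 h0'
      rw [Int.natAbs_mul, Int.natAbs_pow, Int.natAbs_natCast] at h ⊢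
      have h2 : (x' ^ 2 - a * y' ^ 2).natAbs ≤ N := by
        have := hp.two_le
        have h4 : 4 ≤ p ^ 2 := by nlinarith
        have h5 := Nat.mul_le_mul_right (x' ^ 2 - a * y' ^ 2).natAbs h4
        omega
      rw [Nat.factorization_mul (pow_ne_zero 2 hp.ne_zero) h1, Finsupp.add_apply,
        hp.factorization_pow, Finsupp.single_eq_same]
      exact (even_two).add (ih x' y' h2 h0')
    · rw [Nat.factorization_eq_zero_of_not_dvd]
      · exact Even.zero
      · intro h'
        exact hd (Int.natCast_dvd.2 h')

lemma psi_form (e : ℤ) (he : legendreSym 17 e = 1) (N : ℕ) :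
    ∀ x y : ℤ, (x ^ 2 - 17 * e * y ^ 2).natAbs ≤ N → x ^ 2 - 17 * e * y ^ 2 ≠ 0 →
      psi (x ^ 2 - 17 * e * y ^ 2).natAbs = 1 := by
  have hp : Prime (17 : ℤ) := by norm_num
  have hz : ∀ x : ℤ, ¬ (17 : ℤ) ∣ x → (x : ZMod 17) ≠ 0 := by
    intro x hx h
    exact hx ((ZMod.intCast_zmod_eq_zero_iff_dvd x 17).1 h)
  have he' : ¬ (17 : ℤ) ∣ e := by
    intro h
    have := (legendreSym.eq_zero_iff 17 e).2 ((ZMod.intCast_zmod_eq_zero_iff_dvd e 17).2 h)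
    omega
  induction N with
  | zero =>
    intro x y h h0
    exact absurd (Int.natAbs_eq_zero.1 (Nat.le_zero.1 h)) h0
  | succ N ih =>
    intro x y h h0
    by_cases hx : (17 : ℤ) ∣ x
    · obtain ⟨x', rfl⟩ := hx
      by_cases hy : (17 : ℤ) ∣ y
      · obtain ⟨y', rfl⟩ := hy
        have e1 : (17 * x') ^ 2 - 17 * e * (17 * y') ^ 2 =
          (17 * 17) * (x' ^ 2 - 17 * e * y' ^ 2) := by ring
        rw [e1] at h h0 ⊢
        rw [Int.natAbs_mul] at h ⊢
        have h1 : (17 * 17 : ℤ).natAbs = 17 * 17 := rfl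
        have h0' := right_ne_zero_of_mul h0
        have := Int.natAbs_ne_zero.2 h0'
        rw [h1] at h ⊢
        rw [psi_mul, psi_mul, psi_seventeen, ih x' y' (by omega) h0']
        rfl
      · have e1 : (17 * x') ^ 2 - 17 * e * y ^ 2 = 17 * (17 * x' ^ 2 - e * y ^ 2) := by ring
        rw [e1, Int.natAbs_mul, psi_mul]
        have h1 : (17 : ℤ).natAbs = 17 := rfl
        rw [h1, psi_seventeen, one_mul, psi_natAbs]
        · have : legendreSym 17 (17 * x' ^ 2 - e * y ^ 2) = legendreSym 17 (-(e * y ^ 2)) := by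
            rw [legendreSym.mod, legendreSym.mod 17 (-(e * y ^ 2))]
            congr 1
            push_cast
            omega
          rw [this, leg_neg, legendreSym.mul, he, legendreSym.sq_one' 17 (hz y hy)]
          rfl
        · intro hd
          have : (17 : ℤ) ∣ e * y ^ 2 := by omega
          rcases hp.dvd_or_dvd this with h | h
          · exact he' h
          · exact hy (hp.dvd_of_dvd_pow h)
    · have h17 : ∃ k : ℤ, 17 * e * y ^ 2 = 17 * k := ⟨e * y ^ 2, by ring⟩
      obtain ⟨k, hk⟩ := h17
      rw [hk, psi_natAbs]
      · have : legendreSym 17 (x ^ 2 - 17 * k) = legendreSym 17 (x ^ 2) := by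
          rw [legendreSym.mod, legendreSym.mod 17 (x ^ 2)]
          congr 1
          push_cast
          omega
        rw [this, legendreSym.sq_one' 17 (hz x hx)]
      · intro hd
        exact hx (hp.dvd_of_dvd_pow (n := 2) (by omega))

lemma leg_13 : legendreSym 17 13 = 1 := by
  rw [legendreSym.eq_one_iff 17 (by decide)]
  exact ⟨8, by decide⟩

lemma leg_5 : legendreSym 17 5 = -1 := by
  rw [legendreSym.eq_neg_one_iff]
  decide

lemma nsq_5 : ¬ IsSquare ((13 : ℤ) : ZMod 5) := by decide

lemma no_int (x y z t u w d : ℤ) (hd : d ≠ 0)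
    (h : (x ^ 2 - 13 * y ^ 2) * (z ^ 2 - 17 * t ^ 2) * (u ^ 2 - 221 * w ^ 2) = 5 * d ^ 2) :
    False := by
  have hne : (5 * d ^ 2 : ℤ) ≠ 0 := by positivity
  rw [← h] at hne
  have hC0 := right_ne_zero_of_mul hne
  have hA0 := left_ne_zero_of_mul (left_ne_zero_of_mul hne)
  have hB0 := right_ne_zero_of_mul (left_ne_zero_of_mul hne)
  have hB : psi (z ^ 2 - 17 * t ^ 2).natAbs = 1 := by
    have := psi_form 1 (by simp) _ z t le_rfl (by simpa using hB0)
    simpa using this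
  have hC : psi (u ^ 2 - 221 * w ^ 2).natAbs = 1 := by
    have := psi_form 13 leg_13 _ u w le_rfl (by norm_num; exact hC0)
    norm_num at this
    exact this
  have hnat : (x ^ 2 - 13 * y ^ 2).natAbs * (z ^ 2 - 17 * t ^ 2).natAbs *
      (u ^ 2 - 221 * w ^ 2).natAbs = 5 * d.natAbs ^ 2 := by
    rw [← Int.natAbs_mul, ← Int.natAbs_mul, h, Int.natAbs_mul, Int.natAbs_pow]
    rfl
  have hA0' := Int.natAbs_ne_zero.2 hA0
  have hB0' := Int.natAbs_ne_zero.2 hB0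
  have hC0' := Int.natAbs_ne_zero.2 hC0
  have hd' := Int.natAbs_ne_zero.2 hd
  have hA : psi (x ^ 2 - 13 * y ^ 2).natAbs = 1 := by
    apply psi_eq_one _ hA0'
    intro p hp hodd
    have : Fact p.Prime := ⟨hp⟩
    by_cases h17 : p = 17
    · subst h17; exact psi_seventeen
    have hnd : ¬ 17 ∣ p := fun h => h17 ((Nat.prime_dvd_prime_iff_eq (by norm_num) hp).1 h).symm
    rw [psi_of_not_dvd p hnd]
    by_cases h2 : p = 2
    · subst h2
      rw [legendreSym.eq_one_iff 17 (by decide)]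
      exact ⟨6, by decide⟩
    by_cases h13 : p = 13
    · subst h13; exact leg_13
    have hrec := legendreSym.quadratic_reciprocity_one_mod_four (p := 17) (q := p) (by norm_num) h2
    have z17 : ((17 : ℤ) : ZMod p) ≠ 0 := by
      intro h
      have h := (ZMod.intCast_zmod_eq_zero_iff_dvd 17 p).1 h
      have h : p ∣ 17 := by exact_mod_cast h
      exact h17 ((Nat.prime_dvd_prime_iff_eq hp (by norm_num)).1 h)
    have z13 : ((13 : ℤ) : ZMod p) ≠ 0 := by
      intro h
      have h := (ZMod.intCast_zmod_eq_zero_iff_dvd 13 p).1 h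
      have h : p ∣ 13 := by exact_mod_cast h
      exact h13 ((Nat.prime_dvd_prime_iff_eq hp (by norm_num)).1 h)
    rw [← hrec]
    rcases legendreSym.eq_one_or_neg_one p z17 with h1 | h1
    · exact h1
    exfalso
    have h2' : legendreSym p 13 = 1 := by
      rcases legendreSym.eq_one_or_neg_one p z13 with h2 | h2
      · exact h2
      · exact absurd (even_val p 13 h2 _ x y le_rfl hA0) (Nat.not_even_iff_odd.2 hodd)
    have h3 : legendreSym p 221 = -1 := by
      have : (221 : ℤ) = 17 * 13 := by norm_num
      rw [this, legendreSym.mul, h1, h2']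
      rfl
    have eB := even_val p 17 h1 _ z t le_rfl hB0
    have eC := even_val p 221 h3 _ u w le_rfl hC0
    have hv := congrArg (fun n : ℕ => n.factorization p) hnat
    rw [Nat.factorization_mul (mul_ne_zero hA0' hB0') hC0', Nat.factorization_mul hA0' hB0',
      Nat.factorization_mul (by norm_num) (pow_ne_zero 2 hd'), Nat.factorization_pow] at hv
    simp only [Finsupp.add_apply, Finsupp.smul_apply, smul_eq_mul] at hv
    have h5 : p = 5 := by
      by_contra h5
      have : Nat.factorization 5 p = 0 := by
        apply Nat.factorization_eq_zero_of_not_dvd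
        intro h
        exact h5 ((Nat.prime_dvd_prime_iff_eq hp (by norm_num)).1 h)
      rw [this] at hv
      obtain ⟨i, hi⟩ := hodd
      obtain ⟨j, hj⟩ := eB
      obtain ⟨k, hk⟩ := eC
      omega
    subst h5
    have : legendreSym 5 13 = -1 := by
      rw [legendreSym.eq_neg_one_iff]
      exact nsq_5
    omega
  have := congrArg psi hnat
  rw [psi_mul, psi_mul, psi_mul, psi_pow, psi_sq _ hd', hA, hB, hC,
    psi_of_not_dvd 5 (by norm_num)] at this
  have h5 := leg_5
  push_cast at this
  omega

lemma no_rat (x y z t u w : ℚ)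
    (h : (x ^ 2 - 13 * y ^ 2) * (z ^ 2 - 17 * t ^ 2) * (u ^ 2 - 221 * w ^ 2) = 5) : False := by
  have hx : (x.den : ℚ) ≠ 0 := by exact_mod_cast x.den_ne_zero
  have hy : (y.den : ℚ) ≠ 0 := by exact_mod_cast y.den_ne_zero
  have hz : (z.den : ℚ) ≠ 0 := by exact_mod_cast z.den_ne_zero
  have ht : (t.den : ℚ) ≠ 0 := by exact_mod_cast t.den_ne_zero
  have hu : (u.den : ℚ) ≠ 0 := by exact_mod_cast u.den_ne_zero
  have hw : (w.den : ℚ) ≠ 0 := by exact_mod_cast w.den_ne_zero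
  apply no_int (x.num * y.den) (y.num * x.den) (z.num * t.den) (t.num * z.den)
    (u.num * w.den) (w.num * u.den) (x.den * y.den * (z.den * t.den) * (u.den * w.den))
  · have : (x.den * y.den * (z.den * t.den) * (u.den * w.den) : ℚ) ≠ 0 := by
      simp [hx, hy, hz, ht, hu, hw]
    exact_mod_cast this
  · have key : ∀ q : ℚ, (q.num : ℚ) = q * q.den := fun q => (Rat.mul_den_eq_num q).symm
    have : ((x.num * y.den) ^ 2 - 13 * (y.num * x.den) ^ 2) *
        ((z.num * t.den) ^ 2 - 17 * (t.num * z.den) ^ 2) *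
        ((u.num * w.den) ^ 2 - 221 * (w.num * u.den) ^ 2) =
        (5 * (x.den * y.den * (z.den * t.den) * (u.den * w.den)) ^ 2 : ℚ) := by
      rw [key x, key y, key z, key t, key u, key w, ← h]
      ring
    exact_mod_cast this

lemma hensel_sq (p : ℕ) [Fact p.Prime] (a d : ℤ)
    (h : ‖((a ^ 2 - d : ℤ) : ℤ_[p])‖ < ‖((2 * a : ℤ) : ℤ_[p])‖ ^ 2) :
    ∃ s : ℚ_[p], s ^ 2 = d := by
  have := hensels_lemma (p := p) (R := ℤ_[p]) (F := Polynomial.X ^ 2 - Polynomial.C (d : ℤ_[p]))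
    (a := (a : ℤ_[p])) (by simpa [Polynomial.derivative_X_pow, one_add_one_eq_two] using h)
  obtain ⟨s, hs, -⟩ := this
  refine ⟨(s : ℚ_[p]), ?_⟩
  have hs' : s ^ 2 = (d : ℤ_[p]) := by simpa [sub_eq_zero] using hs
  have := congrArg (fun z : ℤ_[p] => (z : ℚ_[p])) hs'
  simpa using this

lemma sq_of_leg (p : ℕ) [Fact p.Prime] (h2 : p ≠ 2) (d : ℤ) (hd : (d : ZMod p) ≠ 0)
    (h : IsSquare (d : ZMod p)) : ∃ s : ℚ_[p], s ^ 2 = d := by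
  have hp : p.Prime := Fact.out
  obtain ⟨r, hr⟩ := h
  obtain ⟨a, rfl⟩ := ZMod.intCast_surjective r
  apply hensel_sq p a d
  have h1 : ‖((a ^ 2 - d : ℤ) : ℤ_[p])‖ < 1 := by
    rw [PadicInt.norm_int_lt_one_iff_dvd, ← ZMod.intCast_zmod_eq_zero_iff_dvd]
    push_cast
    rw [hr]; ring
  have h3 : ¬ ‖((2 * a : ℤ) : ℤ_[p])‖ < 1 := by
    rw [PadicInt.norm_int_lt_one_iff_dvd]
    intro h
    rcases (Nat.prime_iff_prime_int.1 hp).dvd_or_dvd h with h | h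
    · have h : p ∣ 2 := by exact_mod_cast h
      exact h2 ((Nat.prime_dvd_prime_iff_eq hp Nat.prime_two).1 h)
    · rw [(ZMod.intCast_zmod_eq_zero_iff_dvd a p).2 h] at hr
      exact hd (by simpa using hr)
  have h4 : ‖((2 * a : ℤ) : ℤ_[p])‖ = 1 := le_antisymm (PadicInt.norm_le_one _) (not_lt.1 h3)
  rw [h4]
  simpa using h1

lemma surj_form {K : Type*} [Field K] [CharZero K] (s d c : K) (hd : d ≠ 0) (h : s ^ 2 = d) :
    ∃ x y : K, x ^ 2 - d * y ^ 2 = c := by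
  have hs : s ≠ 0 := by rintro rfl; apply hd; rw [← h]; simp
  refine ⟨(c + 1) / 2, (c - 1) / (2 * s), ?_⟩
  rw [← h]
  field_simp
  ring

lemma ne_13 : ((17 : ℤ) : ZMod 13) ≠ 0 := by decide
lemma ne_17 : ((13 : ℤ) : ZMod 17) ≠ 0 := by decide
lemma sq_13 : IsSquare ((17 : ℤ) : ZMod 13) := ⟨2, by decide⟩
lemma sq_17 : IsSquare ((13 : ℤ) : ZMod 17) := ⟨8, by decide⟩

lemma some_sq (p : ℕ) [Fact p.Prime] : (∃ s : ℚ_[p], s ^ 2 = ((13 : ℤ) : ℚ_[p])) ∨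
    (∃ s : ℚ_[p], s ^ 2 = ((17 : ℤ) : ℚ_[p])) ∨ (∃ s : ℚ_[p], s ^ 2 = ((221 : ℤ) : ℚ_[p])) := by
  have hp : p.Prime := Fact.out
  by_cases h2 : p = 2
  · subst h2
    right; left
    apply hensel_sq 2 1 17
    have h1 : ‖(((1 : ℤ) ^ 2 - 17 : ℤ) : ℤ_[2])‖ ≤ (2 : ℝ) ^ (-(4 : ℕ) : ℤ) := by
      have := (PadicInt.norm_int_le_pow_iff_dvd (p := 2) (k := (1 : ℤ) ^ 2 - 17) (n := 4)).2
        (by norm_num)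
      exact_mod_cast this
    have h3 : ‖((2 * 1 : ℤ) : ℤ_[2])‖ = 2⁻¹ := by
      have := PadicInt.norm_p (p := 2)
      simpa using this
    rw [h3]
    refine lt_of_le_of_lt h1 ?_
    norm_num
  by_cases h13 : p = 13
  · subst h13
    right; left
    exact sq_of_leg 13 h2 17 ne_13 sq_13
  by_cases h17 : p = 17
  · subst h17
    left
    exact sq_of_leg 17 h2 13 ne_17 sq_17
  have z17 : ((17 : ℤ) : ZMod p) ≠ 0 := by
    intro h
    have h := (ZMod.intCast_zmod_eq_zero_iff_dvd 17 p).1 h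
    have h : p ∣ 17 := by exact_mod_cast h
    exact h17 ((Nat.prime_dvd_prime_iff_eq hp (by norm_num)).1 h)
  have z13 : ((13 : ℤ) : ZMod p) ≠ 0 := by
    intro h
    have h := (ZMod.intCast_zmod_eq_zero_iff_dvd 13 p).1 h
    have h : p ∣ 13 := by exact_mod_cast h
    exact h13 ((Nat.prime_dvd_prime_iff_eq hp (by norm_num)).1 h)
  have e : (221 : ℤ) = 17 * 13 := by norm_num
  have z221 : ((221 : ℤ) : ZMod p) ≠ 0 := by
    rw [e, Int.cast_mul]; exact mul_ne_zero z17 z13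
  rcases legendreSym.eq_one_or_neg_one p z13 with h | h
  · left; exact sq_of_leg p h2 13 z13 ((legendreSym.eq_one_iff p z13).1 h)
  rcases legendreSym.eq_one_or_neg_one p z17 with hh | hh
  · right; left; exact sq_of_leg p h2 17 z17 ((legendreSym.eq_one_iff p z17).1 hh)
  · right; right
    apply sq_of_leg p h2 221 z221 ((legendreSym.eq_one_iff p z221).1 _)
    rw [e, legendreSym.mul, h, hh]
    rfl

/-- The equation `(x² - 13y²)(z² - 17t²)(u² - 221w²) = 5` is a counterexample to the
Hasse principle: it is solvable over `ℝ` and over every `ℚ_[p]`, but not over `ℚ`. -/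
theorem product_equation_counterexample_to_Hasse :
    (∃ x y z t u w : ℝ,
      (x ^ 2 - 13 * y ^ 2) * (z ^ 2 - 17 * t ^ 2) * (u ^ 2 - 221 * w ^ 2) = 5) ∧
    (∀ (p : ℕ) [Fact p.Prime], ∃ x y z t u w : ℚ_[p],
      (x ^ 2 - 13 * y ^ 2) * (z ^ 2 - 17 * t ^ 2) * (u ^ 2 - 221 * w ^ 2) = 5) ∧
    ¬ (∃ x y z t u w : ℚ,
      (x ^ 2 - 13 * y ^ 2) * (z ^ 2 - 17 * t ^ 2) * (u ^ 2 - 221 * w ^ 2) = 5) := by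
  refine ⟨⟨Real.sqrt 5, 0, 1, 0, 1, 0, ?_⟩, ?_, ?_⟩
  · norm_num
  · intro p _
    rcases some_sq p with ⟨s, hs⟩ | ⟨s, hs⟩ | ⟨s, hs⟩
    · obtain ⟨x, y, hxy⟩ := surj_form s 13 5 (by norm_num) (by simpa using hs)
      exact ⟨x, y, 1, 0, 1, 0, by rw [hxy]; ring⟩
    · obtain ⟨x, y, hxy⟩ := surj_form s 17 5 (by norm_num) (by simpa using hs)
      exact ⟨1, 0, x, y, 1, 0, by rw [hxy]; ring⟩
    · obtain ⟨x, y, hxy⟩ := surj_form s 221 5 (by norm_num) (by simpa using hs)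
      exact ⟨1, 0, 1, 0, x, y, by rw [hxy]; ring⟩
  · rintro ⟨x, y, z, t, u, w, h⟩
    exact no_rat x y z t u w h
end

section
/- There do not exist x, y, z, t, u, w ∈ ℚ such that (x² − 13·y²)·(z² − 17·t²)·(u² − 221·w²) = 5. -/
/-- `q = 17 ^ k * a / b` with `a`, `b` nonzero squares modulo 17. -/
def GoodAt17 (q : ℚ) : Prop :=
  ∃ (k a b : ℤ), (a : ZMod 17) ≠ 0 ∧ (b : ZMod 17) ≠ 0 ∧ IsSquare (a : ZMod 17) ∧
    IsSquare (b : ZMod 17) ∧ q * b = 17 ^ k * a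

theorem fact_prime_seventeen_s10 : Fact (Nat.Prime 17) := ⟨by norm_num⟩

attribute [local instance] fact_prime_seventeen_s10

theorem int_ne_zero_of_mod {a : ℤ} (h : (a : ZMod 17) ≠ 0) : (a : ℚ) ≠ 0 := by
  intro h0
  apply h
  have : a = 0 := by exact_mod_cast h0
  simp [this]

theorem GoodAt17.mul {q r : ℚ} (hq : GoodAt17 q) (hr : GoodAt17 r) : GoodAt17 (q * r) := by
  obtain ⟨k, a, b, ha, hb, sa, sb, h⟩ := hq
  obtain ⟨k', a', b', ha', hb', sa', sb', h'⟩ := hr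
  refine ⟨k + k', a * a', b * b', ?_, ?_, ?_, ?_, ?_⟩
  · push_cast; exact mul_ne_zero ha ha'
  · push_cast; exact mul_ne_zero hb hb'
  · push_cast; exact sa.mul sa'
  · push_cast; exact sb.mul sb'
  · rw [zpow_add₀ (by norm_num)]
    push_cast
    calc q * r * (b * b') = (q * b) * (r * b') := by ring
      _ = _ := by rw [h, h']; ring

theorem GoodAt17.inv {q : ℚ} (hq : GoodAt17 q) : GoodAt17 q⁻¹ := by
  obtain ⟨k, a, b, ha, hb, sa, sb, h⟩ := hq
  refine ⟨-k, b, a, hb, ha, sb, sa, ?_⟩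
  have ha' := int_ne_zero_of_mod ha
  have hb' := int_ne_zero_of_mod hb
  have h17 : (17 : ℚ) ^ k ≠ 0 := zpow_ne_zero _ (by norm_num)
  have hq0 : q ≠ 0 := by
    rintro rfl
    rw [zero_mul] at h
    exact mul_ne_zero h17 ha' h.symm
  rw [zpow_neg]
  field_simp
  linarith

theorem goodAt17_int {a : ℤ} (ha : (a : ZMod 17) ≠ 0) (sa : IsSquare (a : ZMod 17)) :
    GoodAt17 a :=
  ⟨0, a, 1, ha, by simp, sa, by simp, by simp⟩

theorem goodAt17_one : GoodAt17 1 := by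
  simpa using goodAt17_int (a := 1) (by simp) (by simp)

theorem goodAt17_neg_one : GoodAt17 (-1) := by
  simpa using goodAt17_int (a := -1) (by decide) (by decide)

theorem goodAt17_seventeen : GoodAt17 17 :=
  ⟨1, 1, 1, by simp, by simp, by simp, by simp, by simp⟩

theorem GoodAt17.pow {q : ℚ} (hq : GoodAt17 q) (n : ℕ) : GoodAt17 (q ^ n) := by
  induction n with
  | zero => simpa using goodAt17_one
  | succ n ih => rw [pow_succ]; exact ih.mul hq

theorem not_goodAt17_five : ¬ GoodAt17 5 := by
  rintro ⟨k, a, b, ha, hb, sa, sb, h⟩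
  have ha' := int_ne_zero_of_mod ha
  have hb' := int_ne_zero_of_mod hb
  have va : padicValRat 17 (a : ℚ) = 0 := by
    rw [padicValRat.of_int, padicValInt.eq_zero_of_not_dvd]
    · rfl
    · rwa [Ne, ZMod.intCast_zmod_eq_zero_iff_dvd] at ha
  have vb : padicValRat 17 (b : ℚ) = 0 := by
    rw [padicValRat.of_int, padicValInt.eq_zero_of_not_dvd]
    · rfl
    · rwa [Ne, ZMod.intCast_zmod_eq_zero_iff_dvd] at hb
  have v5 : padicValRat 17 (5 : ℚ) = 0 := by
    have : padicValRat 17 ((5 : ℕ) : ℚ) = 0 := by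
      rw [padicValRat.of_nat, padicValNat.eq_zero_of_not_dvd (by norm_num)]; rfl
    exact_mod_cast this
  have v17 : padicValRat 17 (17 : ℚ) = 1 := by
    exact_mod_cast padicValRat.self (p := 17) (by norm_num)
  have hv := congrArg (padicValRat 17) h
  rw [padicValRat.mul (by norm_num) hb', padicValRat.mul (zpow_ne_zero _ (by norm_num)) ha',
    padicValRat.zpow, va, vb, v5, v17] at hv
  have hk : k = 0 := by simpa using hv.symm
  subst hk
  have h2 : (5 : ℤ) * b = a := by
    have : (5 : ℚ) * b = a := by simpa using h
    exact_mod_cast this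
  have h3 : (5 : ZMod 17) * b = a := by exact_mod_cast congrArg (Int.cast : ℤ → ZMod 17) h2
  have h4 : (5 : ZMod 17) = a / b := by rw [← h3]; field_simp
  have h5 : IsSquare (5 : ZMod 17) := by rw [h4]; exact sa.div sb
  revert h5
  decide

theorem goodAt17_prime {p : ℕ} (hp : p.Prime) (h : IsSquare (17 : ZMod p)) :
    GoodAt17 (p : ℚ) := by
  by_cases h17 : p = 17
  · subst h17; exact_mod_cast goodAt17_seventeen
  have : Fact p.Prime := ⟨hp⟩
  have hne : ((p : ℤ) : ZMod 17) ≠ 0 := by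
    rw [Int.cast_natCast, Ne, ZMod.natCast_eq_zero_iff]
    intro hd
    exact h17 ((Nat.prime_dvd_prime_iff_eq (by norm_num) hp).mp hd).symm
  have : GoodAt17 ((p : ℤ) : ℚ) := by
    apply goodAt17_int hne
    by_cases h2 : p = 2
    · subst h2; decide
    · have := (ZMod.exists_sq_eq_prime_iff_of_mod_four_eq_one (p := 17) (q := p)
        (by norm_num) h2)
      rw [Int.cast_natCast]
      first
        | exact this.mp (by exact_mod_cast h)
        | exact this.mpr (by exact_mod_cast h)
  exact_mod_cast this

theorem goodAt17_prime_sq {p : ℕ} (hp : p.Prime) : GoodAt17 ((p : ℚ) ^ 2) := by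
  by_cases h17 : p = 17
  · subst h17; exact_mod_cast goodAt17_seventeen.pow 2
  have hne : ((p : ℤ) : ZMod 17) ≠ 0 := by
    rw [Int.cast_natCast, Ne, ZMod.natCast_eq_zero_iff]
    intro hd
    exact h17 ((Nat.prime_dvd_prime_iff_eq (by norm_num) hp).mp hd).symm
  have := goodAt17_int (a := (p : ℤ) ^ 2) (by push_cast at hne ⊢; exact pow_ne_zero 2 hne)
    (by push_cast; exact IsSquare.sq _)
  exact_mod_cast this

theorem goodAt17_nat {n : ℕ} (hn : n ≠ 0)
    (h : ∀ p : ℕ, p.Prime → ¬ IsSquare (17 : ZMod p) → Even (padicValNat p n)) :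
    GoodAt17 (n : ℚ) := by
  rw [← Nat.prod_factorization_pow_eq_self hn, Finsupp.prod, Nat.cast_prod]
  apply Finset.prod_induction _ GoodAt17 (fun a b ha hb => ha.mul hb) goodAt17_one
  intro p hp
  have hp' : p.Prime := Nat.prime_of_mem_primeFactors (by simpa using hp)
  push_cast
  by_cases hs : IsSquare (17 : ZMod p)
  · exact (goodAt17_prime hp' hs).pow _
  · obtain ⟨r, hr⟩ := h p hp' hs
    rw [Nat.factorization_def n hp', hr, ← two_mul, pow_mul]
    exact (goodAt17_prime_sq hp').pow _

theorem goodAt17_nat_sq {n : ℕ} (hn : n ≠ 0) : GoodAt17 ((n : ℚ) ^ 2) := by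
  have := goodAt17_nat (n := n ^ 2) (pow_ne_zero 2 hn) (by
    intro p hp _
    have : Fact p.Prime := ⟨hp⟩
    rw [padicValNat.pow]
    exact even_two_mul _)
  exact_mod_cast this

theorem goodAt17_int_of_natAbs {m : ℤ} (h : GoodAt17 (m.natAbs : ℚ)) : GoodAt17 (m : ℚ) := by
  rcases Int.natAbs_eq m with e | e
  · rw [e, Int.cast_natCast]; exact h
  · rw [e]
    have := goodAt17_neg_one.mul h
    push_cast at this ⊢
    simpa using this

theorem goodAt17_sq {c : ℚ} (hc : c ≠ 0) : GoodAt17 (c ^ 2) := by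
  have h1 := goodAt17_nat_sq (n := c.num.natAbs) (by simpa using hc)
  have h2 := (goodAt17_nat_sq (n := c.den) c.den_nz).inv
  have : c ^ 2 = (c.num.natAbs : ℚ) ^ 2 * ((c.den : ℚ) ^ 2)⁻¹ := by
    conv_lhs => rw [← Rat.num_div_den c]
    rw [div_pow, div_eq_mul_inv]
    congr 1
    rw [Nat.cast_natAbs, Int.cast_abs, sq_abs]
  rw [this]
  exact h1.mul h2

theorem goodAt17_rat {q : ℚ} (hq : q ≠ 0)
    (h : ∀ p : ℕ, p.Prime → ¬ IsSquare (17 : ZMod p) → Even (padicValRat p q)) :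
    GoodAt17 q := by
  have hd : (q.den : ℚ) ≠ 0 := by exact_mod_cast q.den_nz
  have hm : ((q.num * q.den : ℤ) : ℚ) = q * (q.den : ℚ) ^ 2 := by
    push_cast
    rw [pow_two, ← mul_assoc, Rat.mul_den_eq_num]
  have key : GoodAt17 ((q.num * q.den : ℤ) : ℚ) := by
    apply goodAt17_int_of_natAbs
    apply goodAt17_nat
    · simp [hq]
    · intro p hp hs
      have : Fact p.Prime := ⟨hp⟩
      have h1 := h p hp hs
      have h2 := congrArg (padicValRat p) hm
      rw [padicValRat.mul hq (pow_ne_zero 2 hd), padicValRat.pow, padicValRat.of_int] at h2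
      have h3 : Even ((padicValInt p (q.num * q.den) : ℕ) : ℤ) := by
        rw [h2]
        exact h1.add (by exact_mod_cast even_two_mul _)
      exact_mod_cast h3
  rw [hm] at key
  have := key.mul (goodAt17_sq hd).inv
  rwa [mul_assoc, mul_inv_cancel₀ (pow_ne_zero 2 hd), mul_one] at this

theorem exists_coprime_scale (x y : ℚ) (h : x ≠ 0 ∨ y ≠ 0) :
    ∃ (c : ℚ) (a b : ℤ), c ≠ 0 ∧ IsCoprime a b ∧ x = c * a ∧ y = c * b := by
  have hx : (x.den : ℚ) ≠ 0 := by exact_mod_cast x.den_nz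
  have hy : (y.den : ℚ) ≠ 0 := by exact_mod_cast y.den_nz
  have hg : 0 < Int.gcd (x.num * y.den) (y.num * x.den) := by
    rw [Int.gcd_pos_iff]
    rcases h with h | h
    · left; simp [h]
    · right; simp [h]
  obtain ⟨a, b, hab, h1, h2⟩ := Int.exists_gcd_one hg
  set g := Int.gcd (x.num * y.den) (y.num * x.den)
  have hg' : (g : ℚ) ≠ 0 := by exact_mod_cast hg.ne'
  refine ⟨g / (x.den * y.den), a, b, div_ne_zero hg' (mul_ne_zero hx hy),
    Int.isCoprime_iff_gcd_eq_one.mpr hab, ?_, ?_⟩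
  · have h1' : (x.num : ℚ) * y.den = a * g := by exact_mod_cast h1
    rw [← Rat.mul_den_eq_num] at h1'
    field_simp
    linarith
  · have h2' : (y.num : ℚ) * x.den = b * g := by exact_mod_cast h2
    rw [← Rat.mul_den_eq_num] at h2'
    field_simp
    linarith

theorem even_val_norm {p : ℕ} (hp : p.Prime) (d : ℤ) (hd : ¬ IsSquare (d : ZMod p)) (x y : ℚ)
    (h0 : x ^ 2 - d * y ^ 2 ≠ 0) : Even (padicValRat p (x ^ 2 - d * y ^ 2)) := by
  have : Fact p.Prime := ⟨hp⟩
  obtain ⟨c, a, b, hc, hab, rfl, rfl⟩ := exists_coprime_scale x y (by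
    by_contra hh
    push Not at hh
    apply h0
    simp [hh.1, hh.2])
  have e : (c * a) ^ 2 - d * (c * b) ^ 2 = c ^ 2 * ((a ^ 2 - d * b ^ 2 : ℤ) : ℚ) := by
    push_cast; ring
  rw [e] at h0 ⊢
  rw [padicValRat.mul (left_ne_zero_of_mul h0) (right_ne_zero_of_mul h0), padicValRat.pow,
    padicValRat.of_int, padicValInt.eq_zero_of_not_dvd]
  · simp
  · rw [← ZMod.intCast_zmod_eq_zero_iff_dvd]
    push_cast
    intro hz
    have hb : (b : ZMod p) = 0 := by
      by_contra hb
      apply hd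
      refine ⟨(a : ZMod p) / b, ?_⟩
      field_simp
      linear_combination -hz
    have ha : (a : ZMod p) = 0 := by
      rw [hb] at hz
      simpa using hz
    obtain ⟨r, s, hrs⟩ := hab
    have := congrArg (Int.cast : ℤ → ZMod p) hrs
    push_cast at this
    rw [ha, hb] at this
    simp at this

theorem goodAt17_norm (e : ℤ) (he0 : ((-e : ℤ) : ZMod 17) ≠ 0)
    (he : IsSquare ((-e : ℤ) : ZMod 17)) (x y : ℚ)
    (h0 : x ^ 2 - (17 * e : ℤ) * y ^ 2 ≠ 0) : GoodAt17 (x ^ 2 - (17 * e : ℤ) * y ^ 2) := by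
  have h17 : (17 : ZMod 17) = 0 := by decide
  obtain ⟨c, a, b, hc, hab, rfl, rfl⟩ := exists_coprime_scale x y (by
    by_contra hh
    push Not at hh
    apply h0
    simp [hh.1, hh.2])
  by_cases ha : (a : ZMod 17) = 0
  · have hb : (b : ZMod 17) ≠ 0 := by
      intro hb
      obtain ⟨r, s, hrs⟩ := hab
      have := congrArg (Int.cast : ℤ → ZMod 17) hrs
      push_cast at this
      rw [ha, hb] at this
      simp at this
    obtain ⟨a', rfl⟩ := (ZMod.intCast_zmod_eq_zero_iff_dvd a 17).mp ha
    have key : (((17 * a' ^ 2 - e * b ^ 2 : ℤ)) : ZMod 17) = ((-e : ℤ) : ZMod 17) * b ^ 2 := by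
      push_cast; rw [h17]; ring
    have g := goodAt17_int (a := 17 * a' ^ 2 - e * b ^ 2)
      (by rw [key]; exact mul_ne_zero he0 (pow_ne_zero 2 hb))
      (by rw [key]; exact he.mul (IsSquare.sq _))
    have := ((goodAt17_sq hc).mul goodAt17_seventeen).mul g
    convert this using 1
    push_cast; ring
  · have key : (((a ^ 2 - 17 * e * b ^ 2 : ℤ)) : ZMod 17) = (a : ZMod 17) ^ 2 := by
      push_cast; rw [h17]; ring
    have g := goodAt17_int (a := a ^ 2 - 17 * e * b ^ 2)
      (by rw [key]; exact pow_ne_zero 2 ha)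
      (by rw [key]; exact IsSquare.sq _)
    have := (goodAt17_sq hc).mul g
    convert this using 1
    push_cast; ring

theorem not_isSquare_thirteen_mod_five : ¬ IsSquare (13 : ZMod 5) := by decide

/-- The equation `(x² - 13y²)(z² - 17t²)(u² - 221w²) = 5` has no rational solution. -/
theorem product_equation_no_rational_solution :
    ¬ ∃ x y z t u w : ℚ,
      (x ^ 2 - 13 * y ^ 2) * (z ^ 2 - 17 * t ^ 2) * (u ^ 2 - 221 * w ^ 2) = 5 := by
  rintro ⟨x, y, z, t, u, w, h⟩
  have hne : (x ^ 2 - 13 * y ^ 2) * (z ^ 2 - 17 * t ^ 2) * (u ^ 2 - 221 * w ^ 2) ≠ 0 := by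
    rw [h]; norm_num
  have n3 := right_ne_zero_of_mul hne
  have n12 := left_ne_zero_of_mul hne
  have n1 := left_ne_zero_of_mul n12
  have n2 := right_ne_zero_of_mul n12
  have g2 : GoodAt17 (z ^ 2 - 17 * t ^ 2) := by
    have := goodAt17_norm 1 (by decide) (by decide) z t (by push_cast; simpa using n2)
    push_cast at this
    simpa using this
  have g3 : GoodAt17 (u ^ 2 - 221 * w ^ 2) := by
    have := goodAt17_norm 13 (by decide) (by decide) u w (by push_cast; norm_num; exact n3)
    push_cast at this
    norm_num at this
    exact this
  have g1 : GoodAt17 (x ^ 2 - 13 * y ^ 2) := by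
    apply goodAt17_rat n1
    intro p hp hs
    have : Fact p.Prime := ⟨hp⟩
    by_cases h13 : IsSquare (13 : ZMod p)
    · have e2 := even_val_norm hp 17 (by exact_mod_cast hs) z t (by exact_mod_cast n2)
      have h130 : (13 : ZMod p) ≠ 0 := by
        intro h0
        have h0' : ((13 : ℕ) : ZMod p) = 0 := by exact_mod_cast h0
        rw [ZMod.natCast_eq_zero_iff, Nat.prime_dvd_prime_iff_eq hp (by norm_num)] at h0'
        subst h0'
        exact hs (by decide)
      have e3 := even_val_norm hp 221 (by
        intro h221
        apply hs
        have : (17 : ZMod p) = ((221 : ℤ) : ZMod p) / 13 := by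
          field_simp
          norm_num
        rw [this]
        exact h221.div h13) u w (by exact_mod_cast n3)
      have hp5 : ¬ p ∣ 5 := by
        intro h5
        rw [Nat.prime_dvd_prime_iff_eq hp (by norm_num)] at h5
        subst h5
        exact not_isSquare_thirteen_mod_five h13
      have v5 : padicValRat p (5 : ℚ) = 0 := by
        have : padicValRat p ((5 : ℕ) : ℚ) = 0 := by
          rw [padicValRat.of_nat, padicValNat.eq_zero_of_not_dvd hp5]; rfl
        exact_mod_cast this
      have hv := congrArg (padicValRat p) h
      rw [padicValRat.mul n12 n3, padicValRat.mul n1 n2, v5] at hv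
      push_cast at e2 e3
      obtain ⟨r, hr⟩ := e2
      obtain ⟨s, hs'⟩ := e3
      exact ⟨-r - s, by linarith⟩
    · have := even_val_norm hp 13 (by exact_mod_cast h13) x y (by exact_mod_cast n1)
      exact_mod_cast this
  have := (g1.mul g2).mul g3
  rw [h] at this
  exact not_goodAt17_five this
end

section
/- Let K be a field equipped with a ℚ-algebra structure such that K has dimension 4 over ℚ and K contains elements r, s with r² = 13 and s² = 17 (so K ≅ ℚ(√13, √17)). Then there is no element ξ ∈ K with N_{K/ℚ}(ξ) = 25. -/
open Classical in
/-- sign of primes inert in both subfields -/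
noncomputable def bqPhi (p : ℕ) : ℤ :=
  if ¬ IsSquare (13 : ZMod p) ∧ ¬ IsSquare (17 : ZMod p) then -1 else 1

open Classical in
noncomputable def bqG (a : ZMod 17) : ℤ := if IsSquare a then 1 else -1

noncomputable def bqChi (p : ℕ) : ℤ := if 17 ∣ p then 1 else bqG p

/-- completely multiplicative extension -/
noncomputable def bqM (f : ℕ → ℤ) (n : ℕ) : ℤ := (n.primeFactorsList.map f).prod

lemma bqM_mul (f : ℕ → ℤ) {m n : ℕ} (hm : m ≠ 0) (hn : n ≠ 0) :
    bqM f (m * n) = bqM f m * bqM f n := by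
  unfold bqM
  rw [((Nat.perm_primeFactorsList_mul hm hn).map f).prod_eq, List.map_append, List.prod_append]

lemma bqM_prime (f : ℕ → ℤ) {p : ℕ} (hp : p.Prime) : bqM f p = f p := by
  simp [bqM, Nat.primeFactorsList_prime hp]

lemma bqM_one (n : ℕ) : bqM (fun _ => 1) n = 1 := by
  simp [bqM]

lemma bq_descent (d : ℤ) (p : ℕ) (hp : p.Prime) (hd : ¬ IsSquare (d : ZMod p)) (a b : ℤ)
    (h : (p : ℤ) ∣ a ^ 2 - d * b ^ 2) : (p : ℤ) ∣ a ∧ (p : ℤ) ∣ b := by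
  have := Fact.mk hp
  rw [← ZMod.intCast_zmod_eq_zero_iff_dvd] at h
  push_cast at h
  have hb : (b : ZMod p) = 0 := by
    by_contra hb
    apply hd
    refine ⟨(a : ZMod p) / b, ?_⟩
    field_simp
    linear_combination -h
  have ha : (a : ZMod p) = 0 := by
    rw [hb] at h
    simpa using h
  exact ⟨(ZMod.intCast_zmod_eq_zero_iff_dvd a p).1 ha, (ZMod.intCast_zmod_eq_zero_iff_dvd b p).1 hb⟩

lemma bq_agree (d : ℤ) (f g : ℕ → ℤ) (hf : ∀ p, f p * f p = 1) (hg : ∀ p, g p * g p = 1)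
    (hfg : ∀ p : ℕ, p.Prime → IsSquare (d : ZMod p) → f p = g p) (n : ℕ) :
    ∀ a b : ℤ, (a ^ 2 - d * b ^ 2).natAbs = n → n ≠ 0 → bqM f n = bqM g n := by
  induction n using Nat.strong_induction_on with
  | _ n ih =>
    intro a b hn hn0
    by_cases H : ∃ p : ℕ, p.Prime ∧ p ∣ n ∧ ¬ IsSquare (d : ZMod p)
    · obtain ⟨p, hp, hpn, hsq⟩ := H
      have h1 : (p : ℤ) ∣ a ^ 2 - d * b ^ 2 := by
        rw [← hn] at hpn; exact Int.natCast_dvd.2 hpn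
      obtain ⟨⟨a', rfl⟩, ⟨b', rfl⟩⟩ := bq_descent d p hp hsq a b h1
      have e : n = p * (p * (a' ^ 2 - d * b' ^ 2).natAbs) := by
        rw [← hn, show ((p : ℤ) * a') ^ 2 - d * (p * b') ^ 2 = p * (p * (a' ^ 2 - d * b' ^ 2)) by ring,
          Int.natAbs_mul, Int.natAbs_mul, Int.natAbs_natCast]
      generalize hm : (a' ^ 2 - d * b' ^ 2).natAbs = m at e
      have hm0 : m ≠ 0 := by rintro rfl; simp at e; exact hn0 e
      have hlt : m < n := by
        have := hp.two_le
        have : 0 < m := Nat.pos_of_ne_zero hm0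
        rw [e, ← mul_assoc]; exact lt_mul_of_one_lt_left this (by nlinarith)
      have := ih m hlt a' b' hm hm0
      have hp0 := hp.ne_zero
      rw [e, bqM_mul f hp0 (mul_ne_zero hp0 hm0), bqM_mul f hp0 hm0,
        bqM_mul g hp0 (mul_ne_zero hp0 hm0), bqM_mul g hp0 hm0, bqM_prime f hp, bqM_prime g hp,
        ← mul_assoc, ← mul_assoc, hf, hg, this]
    · push Not at H
      unfold bqM
      congr 1
      apply List.map_congr_left
      intro p hp
      exact hfg p (Nat.prime_of_mem_primeFactorsList hp)
        (H p (Nat.prime_of_mem_primeFactorsList hp) (Nat.dvd_of_mem_primeFactorsList hp))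

lemma bqPhi_sq (p : ℕ) : bqPhi p * bqPhi p = 1 := by
  unfold bqPhi; split_ifs <;> simp

lemma bqG_sq (p : ZMod 17) : bqG p * bqG p = 1 := by
  unfold bqG; split_ifs <;> simp

lemma bqChi_sq (p : ℕ) : bqChi p * bqChi p = 1 := by
  unfold bqChi; split_ifs
  · simp
  · exact bqG_sq _

lemma bqG_mul (a b : ZMod 17) (ha : a ≠ 0) (hb : b ≠ 0) : bqG (a * b) = bqG a * bqG b := by
  have key : ∀ a b : ZMod 17, a ≠ 0 → b ≠ 0 → (IsSquare (a * b) ↔ (IsSquare a ↔ IsSquare b)) := by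
    decide
  have := key a b ha hb
  unfold bqG
  by_cases h1 : IsSquare a <;> by_cases h2 : IsSquare b <;> simp [h1, h2, this]

lemma bqM_chi (n : ℕ) : ¬ 17 ∣ n → bqM bqChi n = bqG n := by
  induction n using Nat.recOnMul with
  | zero => intro h; simp at h
  | one => intro _; simp [bqM, bqG]
  | prime p hp =>
    intro h
    rw [bqM_prime _ hp, bqChi, if_neg h]
  | mul a b ha hb =>
    intro h
    have h1 : ¬ 17 ∣ a := fun h' => h (h'.mul_right _)
    have h2 : ¬ 17 ∣ b := fun h' => h (h'.mul_left _)
    rw [bqM_mul _ (by rintro rfl; simp at h1) (by rintro rfl; simp at h2), ha h1, hb h2,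
      Nat.cast_mul, bqG_mul]
    · rwa [Ne, ZMod.natCast_eq_zero_iff]
    · rwa [Ne, ZMod.natCast_eq_zero_iff]

lemma bqM_chi_int (M : ℤ) (h0 : (M : ZMod 17) ≠ 0) (h : IsSquare (M : ZMod 17)) :
    bqM bqChi M.natAbs = 1 := by
  have h17 : ¬ 17 ∣ M.natAbs := by
    intro h'
    exact h0 ((ZMod.intCast_zmod_eq_zero_iff_dvd M 17).2 (Int.natCast_dvd.2 h'))
  rw [bqM_chi _ h17, bqG, if_pos]
  have hc : ((M.natAbs : ℤ) : ZMod 17) = M ∨ ((M.natAbs : ℤ) : ZMod 17) = -M := by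
    rcases Int.natAbs_eq M with h | h
    · left; rw [← h]
    · right; rw [h]; simp
  rw [Int.cast_natCast] at hc
  rcases hc with hc | hc
  · rwa [hc]
  · rw [hc]
    revert h
    generalize (M : ZMod 17) = x
    revert x
    decide

lemma prime17 : Nat.Prime 17 := by norm_num

lemma bqM_chi_17 {m : ℕ} (hm : m ≠ 0) : bqM bqChi (17 * m) = bqM bqChi m := by
  rw [bqM_mul _ (by norm_num) hm, bqM_prime _ prime17]
  simp [bqChi]

lemma bq_genus (n : ℕ) :
    ∀ e f : ℤ, (e ^ 2 - 221 * f ^ 2).natAbs = n → n ≠ 0 → bqM bqChi n = 1 := by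
  induction n using Nat.strong_induction_on with
  | _ n ih =>
    intro e f hn hn0
    have c17 : (17 : ZMod 17) = 0 := by decide
    have c2 : (2 : ZMod 17) ≠ 0 := by decide
    have := Fact.mk prime17
    by_cases he : (17 : ℤ) ∣ e
    · obtain ⟨e', rfl⟩ := he
      have e1 : n = 17 * (17 * e' ^ 2 - 13 * f ^ 2).natAbs := by
        rw [← hn, show ((17 : ℤ) * e') ^ 2 - 221 * f ^ 2 = 17 * (17 * e' ^ 2 - 13 * f ^ 2) by ring,
          Int.natAbs_mul]; rfl
      have hm0 : (17 * e' ^ 2 - 13 * f ^ 2).natAbs ≠ 0 := by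
        intro h; rw [h] at e1; exact hn0 (by simpa using e1)
      rw [e1, bqM_chi_17 hm0]
      by_cases hf : (17 : ℤ) ∣ f
      · obtain ⟨f', rfl⟩ := hf
        have e2 : (17 * e' ^ 2 - 13 * (17 * f') ^ 2).natAbs = 17 * (e' ^ 2 - 221 * f' ^ 2).natAbs := by
          rw [show 17 * e' ^ 2 - 13 * (17 * f') ^ 2 = 17 * (e' ^ 2 - 221 * f' ^ 2) by ring,
          Int.natAbs_mul]; rfl
        rw [e2] at hm0 e1 ⊢
        have hk : (e' ^ 2 - 221 * f' ^ 2).natAbs ≠ 0 := fun h => hm0 (by rw [h])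
        rw [bqM_chi_17 hk]
        exact ih _ (by omega) e' f' rfl hk
      · have hf' : (f : ZMod 17) ≠ 0 := fun h => hf ((ZMod.intCast_zmod_eq_zero_iff_dvd f 17).1 h)
        have e3 : ((17 * e' ^ 2 - 13 * f ^ 2 : ℤ) : ZMod 17) = (2 * f) ^ 2 := by
          push_cast
          linear_combination (e' ^ 2 - f ^ 2 : ZMod 17) * c17
        apply bqM_chi_int
        · rw [e3]
          exact pow_ne_zero _ (mul_ne_zero c2 hf')
        · rw [e3]; exact ⟨_, sq _⟩
    · have he' : (e : ZMod 17) ≠ 0 := fun h => he ((ZMod.intCast_zmod_eq_zero_iff_dvd e 17).1 h)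
      have e3 : ((e ^ 2 - 221 * f ^ 2 : ℤ) : ZMod 17) = e ^ 2 := by
        push_cast
        linear_combination (-13 * f ^ 2 : ZMod 17) * c17
      rw [← hn]
      apply bqM_chi_int
      · rw [e3]; exact pow_ne_zero _ he'
      · rw [e3]; exact ⟨_, sq _⟩

lemma bq_phi_chi (p : ℕ) (hp : p.Prime) (h : IsSquare ((221 : ℤ) : ZMod p)) :
    bqPhi p = bqChi p := by
  by_cases h2 : p = 2
  · subst h2
    have a : IsSquare (13 : ZMod 2) := by decide
    have b : IsSquare (2 : ZMod 17) := by decide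
    simp [bqPhi, bqChi, bqG, a, b]
  by_cases h13 : p = 13
  · subst h13
    have a : IsSquare (13 : ZMod 13) := by decide
    have b : IsSquare (13 : ZMod 17) := by decide
    simp [bqPhi, bqChi, bqG, a, b]
  by_cases h17 : p = 17
  · subst h17
    have a : IsSquare (17 : ZMod 17) := by decide
    simp [bqPhi, bqChi, a]
  have := Fact.mk hp
  have := Fact.mk prime17
  have n13 : (13 : ZMod p) ≠ 0 := by
    intro h
    have : ((13 : ℕ) : ZMod p) = 0 := by exact_mod_cast h
    rw [ZMod.natCast_eq_zero_iff, Nat.prime_dvd_prime_iff_eq hp (by norm_num)] at this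
    exact h13 this
  have n17 : (17 : ZMod p) ≠ 0 := by
    intro h
    have : ((17 : ℕ) : ZMod p) = 0 := by exact_mod_cast h
    rw [ZMod.natCast_eq_zero_iff, Nat.prime_dvd_prime_iff_eq hp (by norm_num)] at this
    exact h17 this
  have nd : ¬ 17 ∣ p := by
    rw [Nat.prime_dvd_prime_iff_eq prime17 hp]; exact fun h => h17 h.symm
  have hrec : IsSquare (p : ZMod 17) ↔ IsSquare (17 : ZMod p) := by
    have := ZMod.exists_sq_eq_prime_iff_of_mod_four_eq_one (p := 17) (q := p) (by norm_num) h2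
    exact_mod_cast this
  have h' : IsSquare ((13 : ZMod p) * 17) := by
    have : ((221 : ℤ) : ZMod p) = 13 * 17 := by push_cast; norm_num
    rwa [this] at h
  obtain ⟨t, ht⟩ := h'
  have imp : IsSquare (13 : ZMod p) → IsSquare (17 : ZMod p) := by
    rintro ⟨u, hu⟩
    have : u ≠ 0 := by rintro rfl; simp at hu; exact n13 hu
    refine ⟨t / u, ?_⟩
    field_simp
    linear_combination ht - 17 * hu
  unfold bqPhi bqChi bqG
  rw [if_neg nd]
  by_cases hh : IsSquare (17 : ZMod p)
  · simp [hh, hrec]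
  · have : ¬ IsSquare (13 : ZMod p) := fun h => hh (imp h)
    simp [hh, hrec, this]

lemma bq_int (a b c d e f : ℤ) (h0 : a ^ 2 - 13 * b ^ 2 ≠ 0)
    (h : 5 * (a ^ 2 - 13 * b ^ 2) = (c ^ 2 - 17 * d ^ 2) * (e ^ 2 - 221 * f ^ 2)) : False := by
  have h1 : c ^ 2 - 17 * d ^ 2 ≠ 0 := by
    intro h'; rw [h'] at h; apply h0; linarith
  have h2 : e ^ 2 - 221 * f ^ 2 ≠ 0 := by
    intro h'; rw [h'] at h; apply h0; linarith
  have key := congrArg Int.natAbs h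
  rw [Int.natAbs_mul, Int.natAbs_mul] at key
  have p0 := Int.natAbs_ne_zero.2 h0
  have p1 := Int.natAbs_ne_zero.2 h1
  have p2 := Int.natAbs_ne_zero.2 h2
  have A := bq_agree 13 bqPhi (fun _ => 1) bqPhi_sq (by simp)
    (by intro p _ h; have h : IsSquare (13 : ZMod p) := by exact_mod_cast h
        simp [bqPhi, h]) _ a b rfl p0
  have B := bq_agree 17 bqPhi (fun _ => 1) bqPhi_sq (by simp)
    (by intro p _ h; have h : IsSquare (17 : ZMod p) := by exact_mod_cast h
        simp [bqPhi, h]) _ c d rfl p1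
  have C := bq_agree 221 bqPhi bqChi bqPhi_sq bqChi_sq bq_phi_chi _ e f rfl p2
  rw [bq_genus _ e f rfl p2] at C
  rw [bqM_one] at A B
  have key2 := congrArg (bqM bqPhi) key
  rw [bqM_mul _ (by norm_num) p0, bqM_mul _ p1 p2, A, B, C] at key2
  have five : bqM bqPhi (Int.natAbs 5) = -1 := by
    change bqM bqPhi 5 = -1
    rw [bqM_prime _ (by norm_num)]
    have a : ¬ IsSquare (13 : ZMod 5) := by decide
    have b : ¬ IsSquare (17 : ZMod 5) := by decide
    simp [bqPhi, a, b]
  rw [five] at key2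
  norm_num at key2

lemma bq_clear (x y : ℚ) : ∃ (k : ℤ) (a b : ℤ), k ≠ 0 ∧ (k : ℚ) * x = a ∧ (k : ℚ) * y = b := by
  refine ⟨x.den * y.den, x.num * y.den, y.num * x.den, by simp, ?_, ?_⟩
  · push_cast
    have := Rat.mul_den_eq_num x
    linear_combination (y.den : ℚ) * this
  · push_cast
    have := Rat.mul_den_eq_num y
    linear_combination (x.den : ℚ) * this

lemma bq_rat (a b c d e f : ℚ) (h0 : a ^ 2 - 13 * b ^ 2 ≠ 0)
    (h : 5 * (a ^ 2 - 13 * b ^ 2) = (c ^ 2 - 17 * d ^ 2) * (e ^ 2 - 221 * f ^ 2)) : False := by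
  obtain ⟨k, a', b', hk, ha, hb⟩ := bq_clear a b
  obtain ⟨l, c', d', hl, hc, hd⟩ := bq_clear c d
  obtain ⟨m, e', f', hm, he, hf⟩ := bq_clear e f
  have hk' : (k : ℚ) ≠ 0 := by exact_mod_cast hk
  have hl' : (l : ℚ) ≠ 0 := by exact_mod_cast hl
  have hm' : (m : ℚ) ≠ 0 := by exact_mod_cast hm
  apply bq_int (l * m * a') (l * m * b') (k * c') (k * d') e' f'
  · intro h1
    have h2 : ((l * m * a' : ℚ)) ^ 2 - 13 * (l * m * b') ^ 2 = 0 := by exact_mod_cast h1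
    rw [← ha, ← hb] at h2
    apply h0
    have : (l * m * k : ℚ) ^ 2 * (a ^ 2 - 13 * b ^ 2) = 0 := by linear_combination h2
    rcases mul_eq_zero.1 this with h | h
    · exact absurd h (pow_ne_zero _ (mul_ne_zero (mul_ne_zero hl' hm') hk'))
    · exact h
  · have : (5 : ℚ) * ((l * m * a') ^ 2 - 13 * (l * m * b') ^ 2) =
        ((k * c') ^ 2 - 17 * (k * d') ^ 2) * (e' ^ 2 - 221 * f' ^ 2) := by
      rw [← ha, ← hb, ← hc, ← hd, ← he, ← hf]
      linear_combination (l * m * k : ℚ) ^ 2 * h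
    exact_mod_cast this

lemma bq_split (a b X1 X2 Y1 Y2 : ℚ) (h0 : a ^ 2 - 13 * b ^ 2 ≠ 0) (hX : X1 * X2 = 17 * Y1 * Y2)
    (h : X1 ^ 2 + 13 * X2 ^ 2 - 17 * Y1 ^ 2 - 221 * Y2 ^ 2 = 5 * (a ^ 2 - 13 * b ^ 2)) : False := by
  by_cases hY : Y1 = 0
  · subst hY
    rcases mul_eq_zero.1 (show X1 * X2 = 0 by linarith) with hx | hx
    · subst hx
      apply bq_rat (13 * b) a (13 * (4 * X2 + 17 * Y2)) (13 * (X2 + 4 * Y2)) 1 0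
      · intro h'; apply h0; linarith
      · linear_combination 13 * h
    · subst hx
      apply bq_rat a b 1 0 X1 Y2 h0
      linear_combination -h
  · obtain ⟨t, rfl⟩ : ∃ t, X1 = t * Y1 := ⟨X1 / Y1, by field_simp⟩
    have e : t * X2 = 17 * Y2 := by
      apply mul_left_cancel₀ hY; linear_combination hX
    apply bq_rat a b (t / 17) (1 / 17) (17 * Y1) X2 h0
    have e' : Y2 = t * X2 / 17 := by linarith
    subst e'
    linear_combination -h

lemma bq_eq (x y z w A B : ℚ) (hA : A = x ^ 2 + 13 * y ^ 2 - 17 * z ^ 2 - 221 * w ^ 2)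
    (hB : B = 2 * x * y - 34 * z * w) (h : A ^ 2 - 13 * B ^ 2 = 25) : False := by
  by_cases h5 : A = -5
  · have hB0 : B = 0 := by
      have : B ^ 2 = 0 := by rw [h5] at h; linarith
      simpa using this
    apply bq_split 0 1 (13 * y) x (13 * w) z (by norm_num)
    · linear_combination (13 / 2) * (hB0 - hB)
    · linear_combination 13 * h5 - 13 * hA
  · apply bq_split (5 + A) B (x * (5 + A) - 13 * y * B) (y * (5 + A) - x * B)
      (z * (5 + A) - 13 * w * B) (w * (5 + A) - z * B)
    · intro h'
      apply h5
      linarith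
    · have : (5 + A) ^ 2 * B + 13 * B ^ 2 * B - 2 * A * (5 + A) * B = 0 := by
        linear_combination -B * h
      linear_combination (1/2) * this + (5 + A) * B * hA - (1/2) * ((5 + A) ^ 2 + 13 * B ^ 2) * hB
    · have : A * ((5 + A) ^ 2 + 13 * B ^ 2) - 26 * B ^ 2 * (5 + A) = 5 * ((5 + A) ^ 2 - 13 * B ^ 2) := by
        linear_combination (5 + A) * h
      linear_combination this - ((5 + A) ^ 2 + 13 * B ^ 2) * hA + 26 * (5 + A) * B * hB

lemma bq_nsq (n : ℕ) (hn : ¬ IsSquare n) (q : ℚ) : q ^ 2 ≠ n := by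
  intro h
  apply hn
  rw [← Rat.isSquare_natCast_iff]
  exact ⟨q, by rw [← h, sq]⟩

/-- a rational combination of `1` and a root of `13` vanishes only trivially -/
lemma bq_indep1 (K : Type*) [Field K] [Algebra ℚ K] (r : K) (hr : r ^ 2 = 13) (x y : ℚ)
    (h : algebraMap ℚ K x + algebraMap ℚ K y * r = 0) : x = 0 ∧ y = 0 := by
  have h2 : algebraMap ℚ K (x ^ 2 - 13 * y ^ 2) = 0 := by
    simp only [map_sub, map_mul, map_pow, map_ofNat]
    linear_combination (algebraMap ℚ K x - algebraMap ℚ K y * r) * h + (algebraMap ℚ K y) ^ 2 * hr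
  have h3 := (map_eq_zero _).1 h2
  have hy : y = 0 := by
    by_contra hy
    apply bq_nsq 13 (by rintro ⟨k, hk⟩; have hk15 : k < 15 := (by nlinarith); interval_cases k <;> omega) (x / y)
    push_cast
    field_simp
    linarith
  subst hy
  simpa using h3

lemma bq_indep2 (K : Type*) [Field K] [Algebra ℚ K] (r s : K) (hr : r ^ 2 = 13) (hs : s ^ 2 = 17)
    (x y z w : ℚ)
    (h : algebraMap ℚ K x + algebraMap ℚ K y * r + algebraMap ℚ K z * s
      + algebraMap ℚ K w * (r * s) = 0) : x = 0 ∧ y = 0 ∧ z = 0 ∧ w = 0 := by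
  by_cases hzw : z = 0 ∧ w = 0
  · obtain ⟨rfl, rfl⟩ := hzw
    have := bq_indep1 K r hr x y (by simpa using h)
    simp [this]
  exfalso
  have hD : z ^ 2 - 13 * w ^ 2 ≠ 0 := by
    intro h'
    have hw : w = 0 := by
      by_contra hw
      apply bq_nsq 13 (by rintro ⟨k, hk⟩; have hk15 : k < 15 := (by nlinarith); interval_cases k <;> omega) (z / w)
      push_cast
      field_simp
      linarith
    subst hw
    exact hzw ⟨by simpa using h', rfl⟩
  obtain ⟨D, hDd⟩ : ∃ D, D = z ^ 2 - 13 * w ^ 2 := ⟨_, rfl⟩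
  obtain ⟨P, hP⟩ : ∃ P, P = -(x * z - 13 * y * w) := ⟨_, rfl⟩
  obtain ⟨Q, hQ⟩ : ∃ Q, Q = -(y * z - x * w) := ⟨_, rfl⟩
  have h1 : s * algebraMap ℚ K D = algebraMap ℚ K P + algebraMap ℚ K Q * r := by
    rw [hDd, hP, hQ]
    simp only [map_sub, map_mul, map_pow, map_ofNat, map_neg]
    linear_combination (algebraMap ℚ K z - algebraMap ℚ K w * r) * h +
      (algebraMap ℚ K w * algebraMap ℚ K y + algebraMap ℚ K w ^ 2 * s) * hr
  have h2 := bq_indep1 K r hr (P ^ 2 + 13 * Q ^ 2 - 17 * D ^ 2) (2 * P * Q) (by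
    simp only [map_sub, map_add, map_mul, map_pow, map_ofNat]
    linear_combination -(s * algebraMap ℚ K D + algebraMap ℚ K P + algebraMap ℚ K Q * r) * h1
      + algebraMap ℚ K D ^ 2 * hs - algebraMap ℚ K Q ^ 2 * hr)
  obtain ⟨h3, h4⟩ := h2
  rw [← hDd] at hD
  rcases mul_eq_zero.1 h4 with h5 | h5
  · have h5 : P = 0 := by linarith
    apply bq_nsq 221 (by rintro ⟨k, hk⟩; have hk15 : k < 15 := (by nlinarith); interval_cases k <;> omega) (13 * Q / D)
    push_cast
    field_simp
    rw [h5] at h3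
    linarith
  · apply bq_nsq 17 (by rintro ⟨k, hk⟩; have hk15 : k < 15 := (by nlinarith); interval_cases k <;> omega) (P / D)
    push_cast
    field_simp
    rw [h5] at h3
    linarith

/-- In the biquadratic field `K = ℚ(√13, √17)` (any field with a `ℚ`-algebra structure of
dimension 4 over `ℚ` containing square roots of `13` and `17`), no element has norm `25`. -/
theorem no_element_of_norm_25_in_biquadratic_field
    (K : Type*) [Field K] [Algebra ℚ K]
    (hdim : Module.finrank ℚ K = 4)
    (r s : K) (hr : r ^ 2 = 13) (hs : s ^ 2 = 17) :
    ¬ ∃ ξ : K, Algebra.norm ℚ ξ = 25 := by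
  rintro ⟨ξ, hξ⟩
  have hli : LinearIndependent ℚ ![1, r, s, r * s] := by
    rw [Fintype.linearIndependent_iff]
    intro g hg
    simp only [Fin.sum_univ_four, Algebra.smul_def] at hg
    obtain ⟨h0, h1, h2, h3⟩ := bq_indep2 K r s hr hs (g 0) (g 1) (g 2) (g 3) (by simpa using hg)
    intro i
    fin_cases i <;> assumption
  let b := basisOfLinearIndependentOfCardEqFinrank hli (by simp [hdim])
  have hb : ⇑b = ![1, r, s, r * s] := coe_basisOfLinearIndependentOfCardEqFinrank _ _
  have hx := b.sum_repr ξ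
  obtain ⟨x, hx0⟩ : ∃ x, x = b.repr ξ 0 := ⟨_, rfl⟩
  obtain ⟨y, hy0⟩ : ∃ x, x = b.repr ξ 1 := ⟨_, rfl⟩
  obtain ⟨z, hz0⟩ : ∃ x, x = b.repr ξ 2 := ⟨_, rfl⟩
  obtain ⟨w, hw0⟩ : ∃ x, x = b.repr ξ 3 := ⟨_, rfl⟩
  rw [Fin.sum_univ_four, ← hx0, ← hy0, ← hz0, ← hw0, hb] at hx
  simp [Algebra.smul_def, -eq_ratCast] at hx
  let M : Matrix (Fin 4) (Fin 4) ℚ :=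
    !![x, 13 * y, 17 * z, 221 * w;
       y, x, 17 * w, 17 * z;
       z, 13 * w, x, 13 * y;
       w, z, y, x]
  have hM : Algebra.lmul ℚ K ξ = Matrix.toLin b b M := by
    apply b.ext
    intro i
    rw [Matrix.toLin_self, Fin.sum_univ_four, hb, ← hx]
    fin_cases i <;> simp [M, Algebra.smul_def, -eq_ratCast] <;> simp only [map_ofNat]
    · linear_combination (algebraMap ℚ K y + algebraMap ℚ K w * s) * hr
    · linear_combination (algebraMap ℚ K z + algebraMap ℚ K w * r) * hs
    · linear_combination (algebraMap ℚ K y * s + algebraMap ℚ K w * s ^ 2) * hr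
        + (algebraMap ℚ K z * r + 13 * algebraMap ℚ K w) * hs
  rw [Algebra.norm_apply, hM, LinearMap.det_toLin] at hξ
  apply bq_eq x y z w _ _ rfl rfl
  rw [← hξ]
  simp [M, Matrix.det_succ_row_zero, Fin.sum_univ_succ, Fin.succAbove]
  ring
end
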